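/- arXiv:1607.07128 — 2 statements merged into one kernel-verified Lean document; each statement's English description precedes it below -/
import Mathlib

section
/- Let I, J ≥ 1, let U₁, …, U_{I+J−2} ∈ ℂ^{I×J}, c_x ∈ ℂ^I, c_y ∈ ℂ^J, and consider the polynomial system in (x, y) ∈ ℂ^I × ℂ^J consisting of the I+J−2 bilinear equations x^⊤ U_j y = 0 (j = 1, …, I+J−2) together with the two affine equations c_x^⊤ x = 1 and c_y^⊤ y = 1. Then the number of isolated solutions of this system in ℂ^{I+J} is at most the binomial coefficient M = (I−1+J−1)! / ((I−1)!(J−1)!) = C(I+J−2, I−1). -/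
open Matrix

/-- `p` is an isolated solution of `F = 0`: it solves the system and has a
neighborhood containing no other solution. -/
def IsIsolatedSolution {α β : Type*} [TopologicalSpace α] [Zero β] (F : α → β) (p : α) : Prop :=
  F p = 0 ∧ ∃ s ∈ nhds p, ∀ q ∈ s, F q = 0 → q = p

/-- The polynomial system in `(x, y) ∈ ℂ^I × ℂ^J` consisting of the `I+J-2` bilinear
equations `xᵀ U_j y = 0` together with the affine equations `cxᵀ x = 1`, `cyᵀ y = 1`. -/
noncomputable def sysP (I J : ℕ) (U : Fin (I + J - 2) → Matrix (Fin I) (Fin J) ℂ)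
    (cx : Fin I → ℂ) (cy : Fin J → ℂ) (q : (Fin I → ℂ) × (Fin J → ℂ)) :
    (Fin (I + J - 2) → ℂ) × ℂ × ℂ :=
  (fun j => q.1 ⬝ᵥ (U j).mulVec q.2, cx ⬝ᵥ q.1 - 1, cy ⬝ᵥ q.2 - 1)

/-- The translation of affine space by `c`, as an automorphism of the polynomial ring. -/
noncomputable def affineTranslation {k σ : Type*} [CommRing k] (c : σ → k) :
    MvPolynomial σ k ≃ₐ[k] MvPolynomial σ k :=
  AlgEquiv.ofAlgHom (MvPolynomial.aeval fun i => MvPolynomial.X i + MvPolynomial.C (c i))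
    (MvPolynomial.aeval fun i => MvPolynomial.X i - MvPolynomial.C (c i))
    (by ext i; simp [MvPolynomial.algebraMap_eq]) (by ext i; simp [MvPolynomial.algebraMap_eq])

lemma eval_affineTranslation {k σ : Type*} [CommRing k] (c p : σ → k) (f : MvPolynomial σ k) :
    MvPolynomial.eval p (affineTranslation c f) = MvPolynomial.eval (p + c) f := by
  have : (MvPolynomial.aeval p).comp (affineTranslation c).toAlgHom =
      (MvPolynomial.aeval (p + c) : MvPolynomial σ k →ₐ[k] k) := by
    ext i; simp [affineTranslation]
  simpa [MvPolynomial.aeval_eq_eval] using DFunLike.congr_fun this f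

lemma height_ker_eval {k σ : Type*} [Field k] [IsAlgClosed k] [Finite σ] (p : σ → k) :
    (RingHom.ker (MvPolynomial.eval p)).height = Nat.card σ := by
  have : FiniteRingKrullDim (MvPolynomial σ k) := by
    rw [finiteRingKrullDim_iff_ne_bot_and_top, MvPolynomial.ringKrullDim_of_isNoetherianRing,
      ringKrullDim_eq_zero_of_field, zero_add]
    exact ⟨WithBot.coe_ne_bot, fun h => ENat.natCast_ne_top (Nat.card σ) (WithBot.coe_injective h)⟩
  obtain ⟨M, hM, hh⟩ := Ideal.exists_isMaximal_height (R := MvPolynomial σ k)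
  obtain ⟨q, rfl⟩ := MvPolynomial.isMaximal_iff_eq_vanishingIdeal_singleton.mp hM
  rw [MvPolynomial.ringKrullDim_of_isNoetherianRing, ringKrullDim_eq_zero_of_field, zero_add] at hh
  have key : RingHom.ker (MvPolynomial.eval p) =
      (MvPolynomial.vanishingIdeal k {q}).comap (affineTranslation (q - p) : _ ≃+* _).symm := by
    ext f
    simp only [RingHom.mem_ker, Ideal.mem_comap, MvPolynomial.mem_vanishingIdeal_singleton_iff]
    obtain ⟨g, rfl⟩ := (affineTranslation (q - p)).surjective f
    rw [eval_affineTranslation]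
    simp [MvPolynomial.aeval_eq_eval]
  rw [key, RingEquiv.height_comap]
  exact_mod_cast hh

lemma exists_prime_of_deformation {σ ι : Type*} [Finite σ] [Finite ι]
    (hcard : Nat.card ι ≤ Nat.card σ) (f s : ι → MvPolynomial σ ℂ) (p : σ → ℂ)
    (hp : ∀ i, MvPolynomial.eval p (f i) = 0)
    (hiso : ∀ P : Ideal (MvPolynomial σ ℂ), P.IsPrime → (∀ i, f i ∈ P) →
      P ≤ RingHom.ker (MvPolynomial.eval p) → P = RingHom.ker (MvPolynomial.eval p)) :
    ∃ P : Ideal (Polynomial (MvPolynomial σ ℂ)), P.IsPrime ∧ Polynomial.X ∉ P ∧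
      (∀ i, Polynomial.C (f i) + Polynomial.X * Polynomial.C (s i) ∈ P) ∧
      ∀ g ∈ P, MvPolynomial.eval p (g.eval 0) = 0 := by
  set m := RingHom.ker (MvPolynomial.eval p)
  have hsurj : Function.Surjective (MvPolynomial.eval p) := fun c => ⟨MvPolynomial.C c, by simp⟩
  have hm : m.IsMaximal := RingHom.ker_isMaximal_of_surjective _ hsurj
  let ev0 : Polynomial (MvPolynomial σ ℂ) →+* MvPolynomial σ ℂ := Polynomial.evalRingHom 0
  have hev : Function.Surjective ev0 := fun c => ⟨Polynomial.C c, by simp [ev0]⟩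
  let Q := m.comap ev0
  have hQ : Q.IsMaximal := Ideal.comap_isMaximal_of_surjective ev0 hev
  let G : Set (Polynomial (MvPolynomial σ ℂ)) :=
    Set.range fun i => Polynomial.C (f i) + Polynomial.X * Polynomial.C (s i)
  have hGQ : Ideal.span G ≤ Q := by
    rw [Ideal.span_le]
    rintro _ ⟨i, rfl⟩
    simp [Q, ev0, m, hp]
  obtain ⟨P, hPmin, hPQ⟩ := Ideal.exists_minimalPrimes_le hGQ
  have hPp : P.IsPrime := hPmin.1.1
  have hGP : ∀ i, Polynomial.C (f i) + Polynomial.X * Polynomial.C (s i) ∈ P :=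
    fun i => hPmin.1.2 (Ideal.subset_span ⟨i, rfl⟩)
  refine ⟨P, hPp, fun hX => ?_, hGP, fun g hg => hPQ hg⟩
  have hne : P ≠ Q := by
    rintro rfl
    have : Q.LiesOver m := ⟨by ext; simp [Q, ev0]⟩
    have h1 := Polynomial.height_eq_height_add_one m Q
    have h2 := Ideal.height_le_card_of_mem_minimalPrimes_span (Set.finite_range _) hPmin
    have h3 : (Set.range fun i => Polynomial.C (f i) + Polynomial.X * Polynomial.C (s i)).ncard
        ≤ Nat.card ι := by
      rw [← Set.image_univ, ← Set.ncard_univ]; exact Set.ncard_image_le Set.finite_univ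
    rw [h1, height_ker_eval] at h2
    norm_cast at h2
    omega
  have hker : RingHom.ker ev0 ≤ P := by
    intro g hg
    obtain ⟨h, rfl⟩ := Polynomial.X_dvd_iff.mpr
      (by simpa [ev0, RingHom.mem_ker, Polynomial.coeff_zero_eq_eval_zero] using hg)
    exact P.mul_mem_right _ hX
  have hcm : (P.map ev0).comap ev0 = P := by
    rw [Ideal.comap_map_of_surjective' _ hev, sup_eq_left]; exact hker
  apply hne
  have := hiso (P.map ev0) (Ideal.map_isPrime_of_surjective hev hker)
    (fun i => by simpa [ev0] using Ideal.mem_map_of_mem ev0 (hGP i))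
    (Ideal.map_le_iff_le_comap.mpr hPQ)
  rw [← hcm, this]

section Span

variable {k R : Type*} [Field k] [CommRing R] [Algebra k R]

open Submodule in
/-- The part of bidegree `(a + 1, b + 1)` of the ideal generated by the products `L i * M i`
for `i ∈ K`, the `L i` for `i ∈ A` and the `M i` for `i ∈ B`, where `X` and `Y` are the spaces of
forms of bidegree `(1, 0)` and `(0, 1)`. -/
noncomputable def bigradedPart (X Y : Submodule k R) (L M : ℕ → R) (K A B : Finset ℕ) (a b : ℕ) :
    Submodule k R :=
  span k ((fun i => L i * M i) '' K) * (X ^ a * Y ^ b) ⊔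
    span k (L '' A) * (X ^ a * Y ^ (b + 1)) ⊔ span k (M '' B) * (X ^ (a + 1) * Y ^ b)

lemma pow_succ_mul_pow_succ_le {X Y X' Y' : Submodule k R} {ξ η : R} (hX' : X' ≤ X) (hY' : Y' ≤ Y)
    (hξ : ξ ∈ X) (hη : η ∈ Y) (hX : X ≤ X' ⊔ Submodule.span k {ξ})
    (hY : Y ≤ Y' ⊔ Submodule.span k {η}) (a b : ℕ) :
    X ^ (a + 1) * Y ^ (b + 1) ≤ Submodule.span k {ξ ^ (a + 1) * η ^ (b + 1)} ⊔
      (X' * (X ^ a * Y ^ (b + 1)) ⊔ Y' * (X ^ (a + 1) * Y ^ b)) := by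
  have aux : ∀ {Z Z' : Submodule k R} {ζ : R}, Z' ≤ Z → ζ ∈ Z → Z ≤ Z' ⊔ Submodule.span k {ζ} →
      ∀ c : ℕ, Z ^ (c + 1) ≤ Submodule.span k {ζ ^ (c + 1)} ⊔ Z' * Z ^ c := by
    intro Z Z' ζ hZ' hζ hZ c
    have hζ' : Submodule.span k {ζ} ≤ Z := by simpa [Submodule.span_le] using hζ
    induction c with
    | zero => simpa [sup_comm] using hZ
    | succ c ih =>
      calc Z ^ (c + 1 + 1) = Z ^ (c + 1) * Z := pow_succ _ _
        _ ≤ Z ^ (c + 1) * (Z' ⊔ Submodule.span k {ζ}) := mul_le_mul_right hZ _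
        _ = Z ^ (c + 1) * Z' ⊔ Z ^ (c + 1) * Submodule.span k {ζ} := Submodule.mul_sup _ _ _
        _ ≤ _ := by
          refine sup_le ?_ ?_
          · rw [mul_comm]; exact le_sup_right
          · refine (mul_le_mul_left ih _).trans ?_
            rw [Submodule.sup_mul, Submodule.span_mul_span, Set.singleton_mul_singleton,
              ← pow_succ, mul_assoc]
            refine sup_le_sup le_rfl (mul_le_mul_right ?_ _)
            rw [pow_succ]
            exact mul_le_mul_right hζ' _
  have hξ' : Submodule.span k {ξ ^ (a + 1)} ≤ X ^ (a + 1) := by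
    simpa [Submodule.span_le] using Submodule.pow_mem_pow _ hξ _
  calc X ^ (a + 1) * Y ^ (b + 1)
      ≤ (Submodule.span k {ξ ^ (a + 1)} ⊔ X' * X ^ a) * Y ^ (b + 1) :=
        mul_le_mul_left (aux hX' hξ hX a) _
    _ = Submodule.span k {ξ ^ (a + 1)} * Y ^ (b + 1) ⊔ X' * (X ^ a * Y ^ (b + 1)) := by
        rw [Submodule.sup_mul, mul_assoc]
    _ ≤ _ := by
        refine sup_le ?_ (le_sup_left.trans le_sup_right)
        refine (mul_le_mul_right (aux hY' hη hY b) _).trans ?_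
        rw [Submodule.mul_sup, Submodule.span_mul_span, Set.singleton_mul_singleton]
        refine sup_le_sup le_rfl (le_sup_of_le_right ?_)
        rw [mul_left_comm]
        exact mul_le_mul_right (mul_le_mul_left hξ' _) _

/-- Products of general linear forms: in large bidegree, the quotient by the ideal generated by
`L i * M i` for `i ∈ K`, `L i` for `i ∈ A` and `M i` for `i ∈ B` is spanned by as many elements as
there are common zeros. -/
lemma exists_finset_le_span_sup_bigradedPart {X Y : Submodule k R} {L M : ℕ → R} {n m : ℕ}
    (hL : ∀ i, L i ∈ X) (hM : ∀ i, M i ∈ Y)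
    (hX : ∀ A : Finset ℕ, A.card = n + 1 → X ≤ Submodule.span k (L '' A))
    (hY : ∀ B : Finset ℕ, B.card = m + 1 → Y ≤ Submodule.span k (M '' B))
    (K : Finset ℕ) : ∀ (A B : Finset ℕ) (a b : ℕ), Disjoint K A → Disjoint K B →
      A.card ≤ n + 1 → B.card ≤ m + 1 → A.card + B.card + K.card = n + m → K.card ≤ a →
      ∃ t : Finset R, t.card ≤ (if A.card = n + 1 then 0 else K.card.choose (n - A.card)) ∧
        X ^ (a + 1) * Y ^ (b + 1) ≤ Submodule.span k t ⊔ bigradedPart X Y L M K A B a b := by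
  classical
  have fullA : ∀ (K A B : Finset ℕ) (a b : ℕ), A.card = n + 1 →
      X ^ (a + 1) * Y ^ (b + 1) ≤ bigradedPart X Y L M K A B a b := by
    intro K A B a b hA
    refine le_sup_of_le_left (le_sup_of_le_right ?_)
    rw [pow_succ', mul_assoc]
    exact mul_le_mul_left (hX A hA) _
  have fullB : ∀ (K A B : Finset ℕ) (a b : ℕ), B.card = m + 1 →
      X ^ (a + 1) * Y ^ (b + 1) ≤ bigradedPart X Y L M K A B a b := by
    intro K A B a b hB
    refine le_sup_of_le_right ?_
    rw [pow_succ' Y, mul_left_comm]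
    exact mul_le_mul_left (hY B hB) _
  induction K using Finset.induction_on with
  | empty =>
    intro A B a b _ _ hA hB hc _
    by_cases hA' : A.card = n + 1
    · exact ⟨∅, by simp, le_sup_of_le_right (fullA _ _ _ _ _ hA')⟩
    by_cases hB' : B.card = m + 1
    · exact ⟨∅, by simp, le_sup_of_le_right (fullB _ _ _ _ _ hB')⟩
    simp only [Finset.card_empty, add_zero] at hc
    have hAn : A.card = n := by omega
    have hBm : B.card = m := by omega
    obtain ⟨i, hi⟩ := Infinite.exists_notMem_finset A
    obtain ⟨j, hj⟩ := Infinite.exists_notMem_finset B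
    refine ⟨{L i ^ (a + 1) * M j ^ (b + 1)}, by simp [hAn], ?_⟩
    have h := pow_succ_mul_pow_succ_le (X := X) (Y := Y) (X' := Submodule.span k (L '' A))
      (Y' := Submodule.span k (M '' B)) (ξ := L i) (η := M j)
      (by rw [Submodule.span_le]; rintro _ ⟨i, _, rfl⟩; exact hL i)
      (by rw [Submodule.span_le]; rintro _ ⟨i, _, rfl⟩; exact hM i) (hL i) (hM j)
      (by
        have := hX (insert i A) (by simp [hi, hAn])
        rwa [Finset.coe_insert, Set.image_insert_eq, Submodule.span_insert, sup_comm] at this)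
      (by
        have := hY (insert j B) (by simp [hj, hBm])
        rwa [Finset.coe_insert, Set.image_insert_eq, Submodule.span_insert, sup_comm] at this) a b
    simpa [bigradedPart] using h
  | insert l K hl ih =>
    intro A B a b hKA hKB hA hB hc ha
    by_cases hA' : A.card = n + 1
    · exact ⟨∅, by simp, le_sup_of_le_right (fullA _ _ _ _ _ hA')⟩
    by_cases hB' : B.card = m + 1
    · exact ⟨∅, by simp, le_sup_of_le_right (fullB _ _ _ _ _ hB')⟩
    rw [Finset.disjoint_insert_left] at hKA hKB
    rw [Finset.card_insert_of_notMem hl] at hc ha ⊢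
    obtain ⟨a, rfl⟩ : ∃ a', a = a' + 1 := ⟨a - 1, by omega⟩
    have hlA : (insert l A).card = A.card + 1 := Finset.card_insert_of_notMem hKA.1
    have hlB : (insert l B).card = B.card + 1 := Finset.card_insert_of_notMem hKB.1
    obtain ⟨t₁, ht₁, h₁⟩ := ih (insert l A) B (a + 1) b
      (by rw [Finset.disjoint_insert_right]; exact ⟨hl, hKA.2⟩) hKB.2 (by omega) hB (by omega)
      (by omega)
    obtain ⟨t₂, ht₂, h₂⟩ := ih A (insert l B) a b hKA.2
      (by rw [Finset.disjoint_insert_right]; exact ⟨hl, hKB.2⟩) hA (by omega) (by omega)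
      (by omega)
    refine ⟨t₁ ∪ t₂.image (L l * ·), ?_, ?_⟩
    · refine (Finset.card_union_le _ _).trans
        ((add_le_add ht₁ (Finset.card_image_le.trans ht₂)).trans ?_)
      rw [hlA, if_neg hA', if_neg hA']
      split_ifs with h
      · have : n - A.card = 0 := by omega
        simp [this]
      · obtain ⟨c, hc⟩ : ∃ c, n - A.card = c + 1 := ⟨n - A.card - 1, by omega⟩
        have : n - (A.card + 1) = c := by omega
        rw [hc, this, Nat.choose_succ_succ]
    · refine h₁.trans ?_
      have hLX : Submodule.span k {L l} ≤ X := by simpa [Submodule.span_le] using hL l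
      have hsub : bigradedPart X Y L M K A B (a + 1) b ≤
          bigradedPart X Y L M (insert l K) A B (a + 1) b := by
        refine sup_le_sup (sup_le_sup (mul_le_mul_left (Submodule.span_mono ?_) _) le_rfl)
          le_rfl
        exact Set.image_mono (by simp)
      have hmul : Submodule.span k {L l} * bigradedPart X Y L M K A B a b ≤
          bigradedPart X Y L M K A B (a + 1) b := by
        rw [bigradedPart, Submodule.mul_sup, Submodule.mul_sup]
        refine sup_le_sup (sup_le_sup ?_ ?_) ?_ <;>
        · rw [mul_left_comm, ← mul_assoc (Submodule.span k {L l})]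
          exact mul_le_mul_right
            (mul_le_mul_left ((mul_le_mul_left hLX _).trans_eq (pow_succ' X _).symm) _) _
      have hsplit : bigradedPart X Y L M K (insert l A) B (a + 1) b =
          bigradedPart X Y L M K A B (a + 1) b ⊔
            Submodule.span k {L l} * (X ^ (a + 1) * Y ^ (b + 1)) := by
        simp only [bigradedPart, Finset.coe_insert, Set.image_insert_eq, Submodule.span_insert,
          Submodule.sup_mul]
        rw [sup_left_comm, sup_assoc, sup_comm]
      have hsplit' : bigradedPart X Y L M K A (insert l B) a b =
          bigradedPart X Y L M K A B a b ⊔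
            Submodule.span k {M l} * (X ^ (a + 1) * Y ^ b) := by
        simp only [bigradedPart, Finset.coe_insert, Set.image_insert_eq, Submodule.span_insert,
          Submodule.sup_mul]
        rw [sup_comm (Submodule.span k {M l} * _), ← sup_assoc]
      have hprod : Submodule.span k {L l} * (Submodule.span k {M l} * (X ^ (a + 1) * Y ^ b)) ≤
          bigradedPart X Y L M (insert l K) A B (a + 1) b := by
        refine le_sup_of_le_left (le_sup_of_le_left ?_)
        rw [← mul_assoc, Submodule.span_mul_span, Set.singleton_mul_singleton]
        refine mul_le_mul_left (Submodule.span_mono ?_) _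
        simp
      have hlast : Submodule.span k {L l} * (X ^ (a + 1) * Y ^ (b + 1)) ≤
          Submodule.span k (t₂.image (L l * ·) : Finset R) ⊔
            bigradedPart X Y L M (insert l K) A B (a + 1) b := by
        refine (mul_le_mul_right h₂ _).trans ?_
        rw [hsplit', Submodule.mul_sup, Submodule.mul_sup, Submodule.span_mul_span,
          Set.singleton_mul, Finset.coe_image]
        exact sup_le_sup le_rfl (sup_le (hmul.trans hsub) hprod)
      rw [hsplit, Finset.coe_union, Submodule.span_union]
      refine sup_le (le_sup_of_le_left le_sup_left) (sup_le (le_sup_of_le_right hsub) ?_)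
      exact hlast.trans (sup_le_sup le_sup_right le_rfl)

end Span

section Deformation

open Polynomial

variable {k : Type*} [Field k]

lemma exists_polynomial_relation {V : Type*} [AddCommGroup V] [Module k V] [FiniteDimensional k V]
    {d r : ℕ} {e α : Fin d → V} {h : Fin r → V} (he : LinearIndependent k e)
    (hdr : Module.finrank k V < d + r) :
    ∃ (g : Fin d → k[X]) (c : Fin r → k[X]) (n : ℕ), (∃ j, (c j).coeff 0 ≠ 0) ∧
      ∀ φ : V →ₗ[k] k, ∑ i, g i * (C (φ (α i)) + X * C (φ (e i))) +
        X ^ n * ∑ j, c j * C (φ (h j)) = 0 := by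
  classical
  let b := Module.finBasis k V
  let u : Fin d ⊕ Fin r → (Fin (Module.finrank k V) → k[X]) :=
    Sum.elim (fun i l => C (b.repr (α i) l) + X * C (b.repr (e i) l))
      (fun j l => C (b.repr (h j) l))
  have hu : ¬ LinearIndependent k[X] u := by
    intro hu
    have := hu.fintype_card_le_finrank
    simp at this
    omega
  obtain ⟨G, hG, i₀, hi₀⟩ := Fintype.not_linearIndependent_iff.mp hu
  let g : Fin d → k[X] := fun i => G (Sum.inl i)
  let c : Fin r → k[X] := fun j => G (Sum.inr j)
  have hφ : ∀ φ : V →ₗ[k] k, ∑ i, g i * (C (φ (α i)) + X * C (φ (e i))) +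
      ∑ j, c j * C (φ (h j)) = 0 := by
    intro φ
    have hrepr : ∀ v, φ v = ∑ l, b.repr v l * φ (b l) := fun v => by
      calc φ v = φ (∑ l, b.repr v l • b l) := by rw [b.sum_repr]
        _ = _ := by simp only [map_sum, map_smul, smul_eq_mul]
    have hl : ∀ l, ∑ i, g i * (C (b.repr (α i) l) + X * C (b.repr (e i) l)) +
        ∑ j, c j * C (b.repr (h j) l) = 0 := fun l => by
      simpa [u, Fintype.sum_sum_type, g, c] using congrFun hG l
    calc _ = ∑ l, (∑ i, g i * (C (b.repr (α i) l) + X * C (b.repr (e i) l)) +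
        ∑ j, c j * C (b.repr (h j) l)) * C (φ (b l)) := by
          simp_rw [add_mul, Finset.sum_add_distrib, Finset.sum_mul]
          congr 1
          · rw [Finset.sum_comm]
            refine Finset.sum_congr rfl fun i _ => ?_
            rw [hrepr (α i), hrepr (e i), map_sum, map_sum, Finset.mul_sum,
              ← Finset.sum_add_distrib, Finset.mul_sum]
            exact Finset.sum_congr rfl fun l _ => by rw [map_mul, map_mul]; ring
          · rw [Finset.sum_comm]
            refine Finset.sum_congr rfl fun j _ => ?_
            rw [hrepr (h j), map_sum, Finset.mul_sum]
            exact Finset.sum_congr rfl fun l _ => by rw [map_mul]; ring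
      _ = 0 := Finset.sum_eq_zero fun l _ => by rw [hl, zero_mul]
  have hc : ∃ j, c j ≠ 0 := by
    by_contra! hc
    have hg : ∃ i, g i ≠ 0 := by
      rcases i₀ with i | j
      · exact ⟨i, hi₀⟩
      · exact absurd (hc j) hi₀
    obtain ⟨i₂, hi₂, hi₂max⟩ := Finset.exists_max_image
      (Finset.univ.filter fun i => g i ≠ 0) (fun i => (g i).natDegree)
      ⟨hg.choose, by simpa using hg.choose_spec⟩
    set N := (g i₂).natDegree
    have hdeg : ∀ i, (g i).natDegree ≤ N := fun i => by
      by_cases h0 : g i = 0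
      · simp [h0]
      · exact hi₂max i (by simpa using h0)
    have hsum : ∑ i, (g i).coeff N • e i = 0 := by
      refine (Module.forall_dual_apply_eq_zero_iff k _).mp fun φ => ?_
      have := congrArg (fun p => p.coeff (N + 1)) (hφ φ)
      simp only [hc, zero_mul, Finset.sum_const_zero, add_zero, mul_add, finsetSum_coeff,
        coeff_add, coeff_mul_C, coeff_zero, ← mul_assoc, coeff_mul_X,
        coeff_eq_zero_of_natDegree_lt (Nat.lt_succ_of_le (hdeg _)), zero_add] at this
      simpa using this
    have := Fintype.linearIndependent_iff.mp he _ hsum i₂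
    exact (by simpa using hi₂ : g i₂ ≠ 0) (leadingCoeff_eq_zero.mp this)
  obtain ⟨j₀, hj₀, hmin⟩ := Finset.exists_min_image (Finset.univ.filter fun j => c j ≠ 0)
    (fun j => (c j).natTrailingDegree) ⟨hc.choose, by simpa using hc.choose_spec⟩
  replace hj₀ : c j₀ ≠ 0 := by simpa using hj₀
  have hdvd : ∀ j, X ^ (c j₀).natTrailingDegree ∣ c j := fun j => by
    by_cases h0 : c j = 0
    · simp [h0]
    · exact X_pow_dvd_iff.mpr fun l hl => coeff_eq_zero_of_lt_natTrailingDegree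
        (hl.trans_le (hmin j (by simpa using h0)))
  choose c' hc' using hdvd
  refine ⟨g, c', (c j₀).natTrailingDegree, ⟨j₀, fun h0 => hj₀ ?_⟩, fun φ => ?_⟩
  · rw [← trailingCoeff_eq_zero, trailingCoeff]
    have := congrArg (coeff · (0 + (c j₀).natTrailingDegree)) (hc' j₀)
    rwa [coeff_X_pow_mul, h0, zero_add] at this
  · simpa only [Finset.mul_sum, ← mul_assoc, ← hc'] using hφ φ

/-- If the deformations `f i + X * s i` generate, modulo the span of finitely many elements, a
space `V` over the coefficients of highest degree, then any larger family in `V` satisfies a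
relation modulo these deformations that does not vanish at `X = 0`, up to a power of `X`. -/
lemma exists_relation_mod_deformation {R ι : Type*} [CommRing R] [Algebra k R]
    {V W : Submodule k R} [FiniteDimensional k V] {f s : ι → R}
    (hf : ∀ i, ∀ w ∈ W, f i * w ∈ V) (hs : ∀ i, ∀ w ∈ W, s i * w ∈ V) {t : Finset R}
    (ht : V ≤ Submodule.span k t ⊔ Submodule.span k (Set.range s) * W) {r : ℕ} (hr : t.card < r)
    {h : Fin r → R} (hh : ∀ j, h j ∈ V) :
    ∃ (c : Fin r → k[X]) (n : ℕ), (∃ j, (c j).coeff 0 ≠ 0) ∧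
      X ^ n * ∑ j, (c j).map (algebraMap k R) * C (h j) ∈
        Ideal.span (Set.range fun i => C (f i) + X * C (s i)) := by
  set I := Ideal.span (Set.range fun i => C (f i) + X * C (s i))
  set E := Submodule.span k (Set.range s) * W
  have hEα : ∀ e ∈ E, e ∈ V ∧ ∃ α ∈ V, C α + X * C e ∈ I := by
    intro e he
    refine Submodule.mul_induction_on he (fun a ha w hw => ?_) fun a b ha hb => ?_
    · induction ha using Submodule.span_induction with
      | mem a ha =>
        obtain ⟨i, rfl⟩ := ha
        refine ⟨hs i w hw, f i * w, hf i w hw, ?_⟩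
        have : C (f i * w) + X * C (s i * w) = (C (f i) + X * C (s i)) * C w := by
          simp only [map_mul]; ring
        rw [this]
        exact I.mul_mem_right _ (Ideal.subset_span ⟨i, rfl⟩)
      | zero => exact ⟨by simp, 0, V.zero_mem, by simp⟩
      | add a b _ _ ha hb =>
        obtain ⟨h1, α, hα, h2⟩ := ha
        obtain ⟨h3, β, hβ, h4⟩ := hb
        rw [add_mul]
        refine ⟨V.add_mem h1 h3, α + β, V.add_mem hα hβ, ?_⟩
        convert I.add_mem h2 h4 using 1
        simp only [map_add]; ring
      | smul c a _ ha =>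
        obtain ⟨h1, α, hα, h2⟩ := ha
        rw [smul_mul_assoc]
        refine ⟨V.smul_mem c h1, c • α, V.smul_mem c hα, ?_⟩
        convert I.mul_mem_left (C (algebraMap k R c)) h2 using 1
        simp only [Algebra.smul_def, map_mul]; ring
    · obtain ⟨h1, α, hα, h2⟩ := ha
      obtain ⟨h3, β, hβ, h4⟩ := hb
      refine ⟨V.add_mem h1 h3, α + β, V.add_mem hα hβ, ?_⟩
      convert I.add_mem h2 h4 using 1
      simp only [map_add]; ring
  have hEV : E ≤ V := fun e he => (hEα e he).1
  have : FiniteDimensional k E := Submodule.finiteDimensional_of_le hEV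
  have hrank : Module.finrank k V < Module.finrank k E + r := by
    have h1 := Submodule.finrank_mono ht
    have h2 := Submodule.finrank_add_le_finrank_add_finrank (Submodule.span k (t : Set R)) E
    have h3 := finrank_span_finset_le_card (R := k) t
    rw [Set.finrank] at h3
    omega
  let b := Module.finBasis k E
  choose α hαV hαI using fun i => (hEα (b i) (b i).2).2
  obtain ⟨g, c, n, hc, hrel⟩ := exists_polynomial_relation (V := V)
    (e := fun i => ⟨b i, hEV (b i).2⟩) (α := fun i => ⟨α i, hαV i⟩) (h := fun j => ⟨h j, hh j⟩)
    (LinearIndependent.map' b.linearIndependent (Submodule.inclusion hEV)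
      (Submodule.ker_inclusion _ _ _)) hrank
  refine ⟨c, n, hc, ?_⟩
  let bV := Module.finBasis k V
  let ψ : k[X] →+* R[X] := mapRingHom (algebraMap k R)
  have hexp : ∀ v : V, C (v : R) = ∑ l, ψ (C (bV.repr v l)) * C (bV l : R) := fun v => by
    calc C (v : R) = C ((∑ l, bV.repr v l • bV l : V) : R) := by rw [bV.sum_repr]
      _ = _ := by
        simp only [Submodule.coe_sum, Submodule.coe_smul, map_sum, Algebra.smul_def, map_mul, ψ,
          coe_mapRingHom, map_C]
  have hzero : ∑ i, ψ (g i) * (C (α i) + X * C (b i : R)) +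
      X ^ n * ∑ j, ψ (c j) * C (h j) = 0 := by
    calc _ = ∑ l, ψ (∑ i, g i * (C (bV.repr ⟨α i, hαV i⟩ l) +
          X * C (bV.repr ⟨b i, hEV (b i).2⟩ l)) +
          X ^ n * ∑ j, c j * C (bV.repr ⟨h j, hh j⟩ l)) * C (bV l : R) := by
          simp_rw [map_add, map_mul, map_sum, add_mul, Finset.sum_add_distrib, Finset.sum_mul,
            Finset.mul_sum, Finset.sum_mul]
          congr 1
          · rw [Finset.sum_comm]
            refine Finset.sum_congr rfl fun i _ => ?_
            rw [hexp ⟨α i, hαV i⟩, hexp ⟨b i, hEV (b i).2⟩, Finset.mul_sum,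
              ← Finset.sum_add_distrib, Finset.mul_sum]
            refine Finset.sum_congr rfl fun l _ => ?_
            simp only [map_mul, map_add, ψ, coe_mapRingHom, map_X]; ring
          · rw [Finset.sum_comm]
            refine Finset.sum_congr rfl fun j _ => ?_
            rw [hexp ⟨h j, hh j⟩, Finset.mul_sum, Finset.mul_sum]
            refine Finset.sum_congr rfl fun l _ => ?_
            simp only [map_mul, map_pow, ψ, coe_mapRingHom, map_X]; ring
      _ = 0 := Finset.sum_eq_zero fun l _ => by
          have := hrel (bV.coord l)
          simp only [Module.Basis.coord_apply] at this
          rw [this, map_zero, zero_mul]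
  rw [add_comm] at hzero
  rw [show X ^ n * ∑ j, (c j).map (algebraMap k R) * C (h j) = _ from
    eq_neg_of_add_eq_zero_left hzero]
  exact I.neg_mem (I.sum_mem fun i _ => I.mul_mem_left _ (hαI i))

end Deformation

section ClassicalTopology

open MvPolynomial Filter Topology

lemma exists_isMaximal_comap_eq {A B : Type*} [CommRing A] [CommRing B] {φ : A →+* B}
    (hφ : φ.IsIntegral) (p : Ideal A) [p.IsMaximal] (hp : RingHom.ker φ ≤ p) :
    ∃ Q : Ideal B, Q.IsMaximal ∧ Q.comap φ = p := by
  let := φ.toAlgebra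
  have : Algebra.IsIntegral A B := ⟨hφ⟩
  obtain ⟨Q, -, hQ, hQp⟩ := Ideal.exists_ideal_over_prime_of_isIntegral p (⊥ : Ideal B) hp
  have : (Q.comap (algebraMap A B)).IsMaximal := by rw [hQp]; infer_instance
  exact ⟨Q, Ideal.isMaximal_of_isIntegral_of_isMaximal_comap Q this, hQp⟩

lemma exists_zero_over {σ τ : Type*} [Finite σ] {P : Ideal (MvPolynomial σ ℂ)} [P.IsPrime]
    {g : MvPolynomial τ ℂ →ₐ[ℂ] MvPolynomial σ ℂ ⧸ P} (ginj : Function.Injective g)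
    (gint : g.IsIntegral) (h : MvPolynomial σ ℂ) :
    ∃ μ : Polynomial (MvPolynomial τ ℂ), μ.Monic ∧ 0 < μ.natDegree ∧
      μ.eval₂ (g : MvPolynomial τ ℂ →+* MvPolynomial σ ℂ ⧸ P) (Ideal.Quotient.mk P h) = 0 ∧
      ∀ (w : τ → ℂ) (c : ℂ), μ.eval₂ (eval w) c = 0 → ∃ z : σ → ℂ,
        (∀ f ∈ P, eval z f = 0) ∧ eval z h = c ∧
        ∀ f i, Ideal.Quotient.mk P f = g (X i) → eval z f = w i := by
  let : Algebra (MvPolynomial τ ℂ) (MvPolynomial σ ℂ ⧸ P) := g.toRingHom.toAlgebra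
  have : FaithfulSMul (MvPolynomial τ ℂ) (MvPolynomial σ ℂ ⧸ P) :=
    (faithfulSMul_iff_algebraMap_injective _ _).mpr ginj
  have hint : IsIntegral (MvPolynomial τ ℂ) (Ideal.Quotient.mk P h) := gint _
  refine ⟨minpoly _ (Ideal.Quotient.mk P h), minpoly.monic hint, minpoly.natDegree_pos hint,
    minpoly.aeval (MvPolynomial τ ℂ) (Ideal.Quotient.mk P h), fun w c hwc => ?_⟩
  let Φ : Polynomial (MvPolynomial τ ℂ) →+* MvPolynomial σ ℂ ⧸ P :=
    Polynomial.eval₂RingHom g.toRingHom (Ideal.Quotient.mk P h)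
  let ev : Polynomial (MvPolynomial τ ℂ) →+* ℂ := Polynomial.eval₂RingHom (eval w) c
  have hΦ : Φ.IsIntegral := by
    refine RingHom.IsIntegral.tower_top Polynomial.C Φ ?_
    have : Φ.comp Polynomial.C = g.toRingHom := by ext <;> simp [Φ]
    rw [this]
    exact gint
  have hmax : (RingHom.ker ev).IsMaximal :=
    RingHom.ker_isMaximal_of_surjective _ fun x => ⟨Polynomial.C (C x), by simp [ev]⟩
  have hker : RingHom.ker Φ ≤ RingHom.ker ev := by
    intro q hq
    obtain ⟨r, rfl⟩ := minpoly.isIntegrallyClosed_dvd hint (p := q) hq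
    rw [RingHom.mem_ker, map_mul]
    exact mul_eq_zero_of_left hwc _
  obtain ⟨Q, hQ, hQev⟩ := exists_isMaximal_comap_eq hΦ _ hker
  have hQ' : (Q.comap (Ideal.Quotient.mk P)).IsMaximal :=
    Ideal.comap_isMaximal_of_surjective _ Ideal.Quotient.mk_surjective
  obtain ⟨z, hz⟩ := MvPolynomial.isMaximal_iff_eq_vanishingIdeal_singleton.mp hQ'
  have hmem : ∀ f, Ideal.Quotient.mk P f ∈ Q ↔ eval z f = 0 := fun f => by
    rw [← Ideal.mem_comap, hz, mem_vanishingIdeal_singleton_iff, aeval_eq_eval]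
  have hev : ∀ q : Polynomial (MvPolynomial τ ℂ), Φ q ∈ Q ↔ ev q = 0 := fun q => by
    rw [← Ideal.mem_comap, hQev, RingHom.mem_ker]
  have hgC : ∀ x : ℂ, g (C x) = Ideal.Quotient.mk P (C x) := fun x => g.commutes x
  refine ⟨z, fun f hf => ?_, ?_, fun f i hfi => ?_⟩
  · rw [← hmem, Ideal.Quotient.eq_zero_iff_mem.mpr hf]
    exact Q.zero_mem
  · have h1 : Φ (Polynomial.X - Polynomial.C (C c)) = Ideal.Quotient.mk P (h - C c) := by
      simp [Φ, hgC]
    have h2 : Φ (Polynomial.X - Polynomial.C (C c)) ∈ Q := (hev _).mpr (by simp [ev])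
    rw [h1, hmem] at h2
    simpa [sub_eq_zero] using h2
  · have h1 : Φ (Polynomial.C (X i) - Polynomial.C (C (w i))) =
        Ideal.Quotient.mk P (f - C (w i)) := by
      simp [Φ, hgC, hfi]
    have h2 : Φ (Polynomial.C (X i) - Polynomial.C (C (w i))) ∈ Q := (hev _).mpr (by simp [ev])
    rw [h1, hmem] at h2
    simpa [sub_eq_zero] using h2

lemma Polynomial.Monic.norm_le_of_isRoot {q : Polynomial ℂ} (hq : q.Monic) {x : ℂ}
    (hx : q.IsRoot x) : ‖x‖ ≤ ∑ j ∈ Finset.range q.natDegree, ‖q.coeff j‖ + 1 := by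
  have h := (hx.norm_lt_cauchyBound hq.ne_zero).le
  refine (NNReal.coe_le_coe.mpr h).trans ?_
  rw [Polynomial.cauchyBound, hq.leadingCoeff]
  simp only [nnnorm_one, div_one, NNReal.coe_add, NNReal.coe_one, add_le_add_iff_right]
  have : (Finset.range q.natDegree).sup (fun j => ‖q.coeff j‖₊) ≤
      ∑ j ∈ Finset.range q.natDegree, ‖q.coeff j‖₊ :=
    Finset.sup_le fun j hj => Finset.single_le_sum (f := fun j => ‖q.coeff j‖₊)
      (fun _ _ => zero_le) hj
  simpa using NNReal.coe_le_coe.mpr this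

lemma Polynomial.Monic.exists_isRoot_norm_pow_le {q : Polynomial ℂ} (hq : q.Monic)
    (hdeg : 0 < q.natDegree) : ∃ x, q.IsRoot x ∧ ‖x‖ ^ q.natDegree ≤ ‖q.coeff 0‖ := by
  have hs : q.Splits := IsAlgClosed.splits q
  have hcard : q.roots.card = q.natDegree := hs.natDegree_eq_card_roots.symm
  by_contra! hlt
  have hcoeff : ‖q.coeff 0‖ = (q.roots.map (‖·‖)).prod := by
    rw [hs.coeff_zero_eq_prod_roots_of_monic hq]
    simpa using map_multiset_prod (normHom (α := ℂ)) q.roots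
  obtain ⟨x, hx, hmin⟩ := q.roots.toFinset.exists_min_image (‖·‖) (by
    obtain ⟨x, hx⟩ := Multiset.card_pos_iff_exists_mem.mp (hcard ▸ hdeg)
    exact ⟨x, by simpa using hx⟩)
  have hx' : q.IsRoot x := by simp at hx; exact hx.2
  have := hlt x hx'
  rw [hcoeff, ← hcard] at this
  refine absurd this (not_lt.mpr ?_)
  have := Multiset.prod_map_le_prod_map₀ (s := q.roots) (fun _ => ‖x‖) (‖·‖)
    (fun _ _ => norm_nonneg _) (fun y hy => hmin y (by simpa using hy))
  simpa using this

/-- A positive-dimensional irreducible affine variety over `ℂ` has no isolated point in the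
classical topology. -/
lemma exists_zero_ne_of_mem_nhds {σ : Type*} [Fintype σ] {P : Ideal (MvPolynomial σ ℂ)}
    [P.IsPrime] {p : σ → ℂ} (hP : P ≤ RingHom.ker (eval p)) (hne : P ≠ RingHom.ker (eval p))
    {s : Set (σ → ℂ)} (hs : s ∈ 𝓝 p) : ∃ q ∈ s, q ≠ p ∧ ∀ f ∈ P, eval q f = 0 := by
  classical
  have hpP : ∀ f ∈ P, eval p f = 0 := fun f hf => hP hf
  obtain ⟨d, g, ginj, gint⟩ := exists_integral_inj_algHom_of_fg ℂ (MvPolynomial σ ℂ ⧸ P)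
  have hd : Nonempty (Fin d) := by
    by_contra hd
    rw [not_nonempty_iff] at hd
    let : Algebra (MvPolynomial (Fin d) ℂ) (MvPolynomial σ ℂ ⧸ P) := g.toRingHom.toAlgebra
    have : Algebra.IsIntegral (MvPolynomial (Fin d) ℂ) (MvPolynomial σ ℂ ⧸ P) := ⟨gint⟩
    have hf : IsField (MvPolynomial (Fin d) ℂ) :=
      (isEmptyRingEquiv ℂ (Fin d)).toMulEquiv.isField (Field.toIsField ℂ)
    have hmax := Ideal.Quotient.maximal_of_isField P (isField_of_isIntegral_of_isField' hf)
    exact hne (hmax.eq_of_le (RingHom.ker_ne_top _) hP)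
  choose u hu using fun i => Ideal.Quotient.mk_surjective (I := P) (g (X i))
  let π : (σ → ℂ) → Fin d → ℂ := fun z i => eval z (u i)
  have hπ : Continuous π := continuous_pi fun i => (u i).continuous_eval
  -- Evaluating an algebraic relation at a zero of `P`.
  have hrel : ∀ z, (∀ f ∈ P, eval z f = 0) → ∀ (μ : Polynomial (MvPolynomial (Fin d) ℂ)) f,
      μ.eval₂ (g : MvPolynomial (Fin d) ℂ →+* MvPolynomial σ ℂ ⧸ P) (Ideal.Quotient.mk P f) = 0 →
      (μ.map (eval (π z))).IsRoot (eval z f) := by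
    intro z hz μ f hμ
    let ez := Ideal.Quotient.lift P (eval z) hz
    have hcomp : ez.comp (g : MvPolynomial (Fin d) ℂ →+* MvPolynomial σ ℂ ⧸ P) = eval (π z) := by
      ext i
      · have : g (C i) = Ideal.Quotient.mk P (C i) := g.commutes i
        simp [ez, this]
      · simp [ez, ← hu, π]
    have := congrArg ez hμ
    rw [Polynomial.hom_eval₂, hcomp, map_zero] at this
    rw [Polynomial.IsRoot, Polynomial.eval_map]
    simpa [ez] using this
  choose m hm hmdeg hmrel _ using fun i => exists_zero_over ginj gint (X i : MvPolynomial σ ℂ)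
  have hfib : {z | (∀ f ∈ P, eval z f = 0) ∧ π z = π p}.Finite := by
    refine (Set.Finite.pi' fun i => ((m i).map (eval (π p))).roots.toFinset.finite_toSet).subset ?_
    rintro z ⟨hz, hzp⟩ i
    have := hrel z hz (m i) (X i) (hmrel i)
    rw [hzp, eval_X] at this
    simpa [((hm i).map _).ne_zero] using this
  obtain ⟨h, hhp, hhz⟩ : ∃ h : MvPolynomial σ ℂ, eval p h = 0 ∧
      ∀ z, (∀ f ∈ P, eval z f = 0) → π z = π p → z ≠ p → eval z h = 1 := by
    have hsep : ∀ q : σ → ℂ, ∃ v : MvPolynomial σ ℂ, eval p v = 1 ∧ (q ≠ p → eval q v = 0) := by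
      intro q
      by_cases hq : q = p
      · exact ⟨1, by simp, fun h => absurd hq h⟩
      · obtain ⟨i, hi⟩ := Function.ne_iff.mp hq
        have : p i - q i ≠ 0 := sub_ne_zero.mpr (Ne.symm hi)
        exact ⟨C (p i - q i)⁻¹ * (X i - C (q i)), by simp [this], by simp⟩
    choose v hv1 hv0 using hsep
    refine ⟨1 - ∏ q ∈ hfib.toFinset, v q, by simp [hv1], fun z hz hzp hne => ?_⟩
    rw [map_sub, eval_prod, Finset.prod_eq_zero (i := z) (by simpa using ⟨hz, hzp⟩) (hv0 z hne)]
    simp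
  obtain ⟨μ, hμ, hμdeg, hμrel, hμlift⟩ := exists_zero_over ginj gint h
  let w : ℕ → Fin d → ℂ := fun n i => π p i + 1 / ((n : ℂ) + 1)
  have hw : Tendsto w atTop (𝓝 (π p)) := by
    refine tendsto_pi_nhds.mpr fun i => ?_
    simpa only [add_zero] using (tendsto_const_nhds (x := π p i)).add
      (tendsto_one_div_add_atTop_nhds_zero_nat (𝕜 := ℂ))
  have hwne : ∀ n, w n ≠ π p := fun n hn => by
    have := congrFun hn hd.some
    simp only [w, add_eq_left, one_div, inv_eq_zero] at this
    exact Nat.cast_add_one_ne_zero n this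
  have hroot : ∀ n, ∃ z, (∀ f ∈ P, eval z f = 0) ∧ π z = w n ∧
      ‖eval z h‖ ^ μ.natDegree ≤ ‖eval (w n) (μ.coeff 0)‖ := fun n => by
    have hdeg := hμ.natDegree_map (eval (w n))
    obtain ⟨c, hc, hcn⟩ := (hμ.map (eval (w n))).exists_isRoot_norm_pow_le (hdeg ▸ hμdeg)
    obtain ⟨z, hz, hzc, hzw⟩ := hμlift (w n) c (by rwa [← Polynomial.eval_map])
    refine ⟨z, hz, funext fun i => hzw _ _ (hu i), ?_⟩
    rw [hdeg, Polynomial.coeff_map] at hcn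
    rwa [hzc]
  choose z hzP hzw hzh using hroot
  have hbdd : ∃ B, ∀ n, z n ∈ Metric.closedBall (0 : σ → ℂ) B := by
    have hB : ∀ i : σ, ∃ B : ℝ, ∀ n, ‖z n i‖ ≤ B := fun i => by
      have hcont : Continuous fun w : Fin d → ℂ =>
          ∑ j ∈ Finset.range (m i).natDegree, ‖eval w ((m i).coeff j)‖ + 1 :=
        (continuous_finsetSum _ fun j _ => ((m i).coeff j).continuous_eval.norm).add
          continuous_const
      obtain ⟨B, hB⟩ := ((hcont.tendsto _).comp hw).bddAbove_range
      refine ⟨B, fun n => le_trans ?_ (hB ⟨n, rfl⟩)⟩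
      have := ((hm i).map _).norm_le_of_isRoot (hrel (z n) (hzP n) (m i) (X i) (hmrel i))
      simpa [hzw, (hm i).natDegree_map] using this
    choose B hB using hB
    refine ⟨∑ i, |B i|, fun n => ?_⟩
    rw [mem_closedBall_zero_iff, pi_norm_le_iff_of_nonneg (by positivity)]
    exact fun i => (hB i n).trans ((le_abs_self _).trans
      (Finset.single_le_sum (f := fun i => |B i|) (fun _ _ => abs_nonneg _) (Finset.mem_univ i)))
  obtain ⟨B, hB⟩ := hbdd
  obtain ⟨a, -, φ, hφ, ha⟩ := (isCompact_closedBall (0 : σ → ℂ) B).tendsto_subseq hB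
  have haP : ∀ f ∈ P, eval a f = 0 := fun f hf => by
    refine tendsto_nhds_unique ((f.continuous_eval.tendsto a).comp ha) ?_
    simp [Function.comp_def, hzP _ f hf]
  have haπ : π a = π p := by
    refine tendsto_nhds_unique ((hπ.tendsto a).comp ha) ?_
    simpa [Function.comp_def, hzw] using hw.comp hφ.tendsto_atTop
  have hah : eval a h = 0 := by
    have h1 : Tendsto (fun n => ‖eval (z (φ n)) h‖ ^ μ.natDegree) atTop
        (𝓝 (‖eval a h‖ ^ μ.natDegree)) :=
      (((h.continuous_eval.tendsto a).comp ha).norm.pow _)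
    have h2 : Tendsto (fun n => ‖eval (w (φ n)) (μ.coeff 0)‖) atTop
        (𝓝 ‖eval (π p) (μ.coeff 0)‖) :=
      (((μ.coeff 0).continuous_eval.tendsto _).comp (hw.comp hφ.tendsto_atTop)).norm
    have h3 : eval (π p) (μ.coeff 0) = 0 := by
      have := hrel p hpP μ h hμrel
      rwa [hhp, Polynomial.IsRoot, ← Polynomial.coeff_zero_eq_eval_zero,
        Polynomial.coeff_map] at this
    have h4 := le_of_tendsto_of_tendsto' h1 h2 fun n => hzh _
    rw [h3, norm_zero] at h4
    exact norm_eq_zero.mp (eq_zero_of_pow_eq_zero (le_antisymm h4 (by positivity)))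
  have hap : a = p := by
    by_contra hap
    have := hhz a haP haπ hap
    simp [hah] at this
  subst hap
  obtain ⟨n, hn⟩ := (ha.eventually_mem hs).exists
  exact ⟨z (φ n), hn, fun h => hwne (φ n) (by rw [← hzw, h]), hzP _⟩

end ClassicalTopology

section Interpolation

variable {k R : Type*} [Field k] [CommRing R] [Algebra k R]

lemma Submodule.prod_mem_pow_card {ι : Type*} {M : Submodule k R} {q : ι → R} (s : Finset ι)
    (hq : ∀ i, q i ∈ M) : ∏ i ∈ s, q i ∈ M ^ s.card := by
  classical
  induction s using Finset.induction_on with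
  | empty => simp [Submodule.one_le.mp le_rfl]
  | insert i s hi ih =>
    rw [Finset.prod_insert hi, Finset.card_insert_of_notMem hi, pow_succ']
    exact Submodule.mul_mem_mul (hq i) ih

lemma exists_interpolation {M : Submodule k R} {r a : ℕ} (hra : r ≤ a) (ev : Fin r → R →+* k)
    {e : R} (heM : e ∈ M) (he : ∀ i, ev i e = 1)
    (hsep : ∀ i j, i ≠ j → ∃ q ∈ M, ev i q = 0 ∧ ev j q ≠ 0) :
    ∃ h : Fin r → R, (∀ j, h j ∈ M ^ a) ∧ (∀ j, ev j (h j) ≠ 0) ∧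
      ∀ i j, i ≠ j → ev i (h j) = 0 := by
  have hsep' : ∀ j i, ∃ q ∈ M, (i ≠ j → ev i q = 0) ∧ ev j q ≠ 0 := fun j i => by
    by_cases hij : i = j
    · exact ⟨e, heM, fun h => absurd hij h, by simp [he]⟩
    · obtain ⟨q, hq, h0, h1⟩ := hsep i j hij
      exact ⟨q, hq, fun _ => h0, h1⟩
  choose q hqM hq0 hq1 using hsep'
  refine ⟨fun j => (∏ i, q j i) * e ^ (a - r), fun j => ?_, fun j => ?_, fun i j hij => ?_⟩
  · have := Submodule.mul_mem_mul (Submodule.prod_mem_pow_card Finset.univ (hqM j))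
      (Submodule.pow_mem_pow M heM (a - r))
    rwa [← pow_add, Finset.card_univ, Fintype.card_fin, Nat.add_sub_cancel' hra] at this
  · simp [he, Finset.prod_ne_zero_iff, hq1]
  · rw [map_mul, map_prod, Finset.prod_eq_zero (Finset.mem_univ i) (hq0 j i hij), zero_mul]

/-- Any `n + 1` distinct points of the moment curve give a spanning set of linear forms. -/
lemma span_range_le_span_momentCurve [CharZero k] {n : ℕ} (x : Fin (n + 1) → R) {A : Finset ℕ}
    (hA : A.card = n + 1) : Submodule.span k (Set.range x) ≤
      Submodule.span k ((fun i : ℕ => ∑ l : Fin (n + 1), (i : k) ^ (l : ℕ) • x l) '' A) := by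
  let e := (A.equivFinOfCardEq hA).symm
  let V := Matrix.vandermonde fun j => ((e j : ℕ) : k)
  have hV : IsUnit V.det := by
    rw [isUnit_iff_ne_zero, Matrix.det_vandermonde_ne_zero_iff]
    exact Nat.cast_injective.comp (Subtype.val_injective.comp e.injective)
  rw [Submodule.span_le]
  rintro _ ⟨l, rfl⟩
  have hx : x l = ∑ j, V⁻¹ l j • ∑ l', V j l' • x l' := by
    simp_rw [Finset.smul_sum, smul_smul]
    rw [Finset.sum_comm]
    simp_rw [← Finset.sum_smul, ← Matrix.mul_apply, Matrix.nonsing_inv_mul V hV,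
      Matrix.one_apply, ite_smul, one_smul, zero_smul]
    simp
  rw [hx]
  exact Submodule.sum_mem _ fun j _ => Submodule.smul_mem _ _ (Submodule.subset_span
    ⟨e j, (e j).2, rfl⟩)

end Interpolation

section BilinearSystem

open MvPolynomial

/-- The polynomials defining `sysP`. -/
noncomputable def sysPPolynomial (I J : ℕ) (U : Fin (I + J - 2) → Matrix (Fin I) (Fin J) ℂ)
    (cx : Fin I → ℂ) (cy : Fin J → ℂ) :
    Fin (I + J - 2) ⊕ Fin 2 → MvPolynomial (Fin I ⊕ Fin J) ℂ :=
  Sum.elim (fun j => ∑ l, ∑ l', U j l l' • (X (Sum.inl l) * X (Sum.inr l')))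
    ![∑ l, cx l • X (Sum.inl l) - 1, ∑ l, cy l • X (Sum.inr l) - 1]

lemma forall_eval_sysPPolynomial_eq_zero_iff {I J : ℕ}
    {U : Fin (I + J - 2) → Matrix (Fin I) (Fin J) ℂ} {cx : Fin I → ℂ} {cy : Fin J → ℂ}
    {p : Fin I ⊕ Fin J → ℂ} : (∀ i, eval p (sysPPolynomial I J U cx cy i) = 0) ↔
      sysP I J U cx cy (p ∘ Sum.inl, p ∘ Sum.inr) = 0 := by
  simp [sysPPolynomial, sysP, Prod.ext_iff, funext_iff, Fin.forall_fin_two, smul_eval,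
    dotProduct, mulVec, Finset.mul_sum, mul_left_comm]

lemma eq_ker_eval_of_isIsolatedSolution {I J : ℕ}
    {U : Fin (I + J - 2) → Matrix (Fin I) (Fin J) ℂ} {cx : Fin I → ℂ} {cy : Fin J → ℂ}
    {p : Fin I ⊕ Fin J → ℂ}
    (hp : IsIsolatedSolution (sysP I J U cx cy) (p ∘ Sum.inl, p ∘ Sum.inr))
    {P : Ideal (MvPolynomial (Fin I ⊕ Fin J) ℂ)} [P.IsPrime]
    (hP : ∀ i, sysPPolynomial I J U cx cy i ∈ P) (hPp : P ≤ RingHom.ker (eval p)) :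
    P = RingHom.ker (eval p) := by
  obtain ⟨-, s, hs, hsp⟩ := hp
  by_contra hne
  let φ : (Fin I ⊕ Fin J → ℂ) ≃ₜ _ := Homeomorph.sumArrowHomeomorphProdArrow
  obtain ⟨q, hq, hqp, hqP⟩ :=
    exists_zero_ne_of_mem_nhds hPp hne (φ.continuous.continuousAt.preimage_mem_nhds hs)
  exact hqp (φ.injective (hsp _ hq
    (forall_eval_sysPPolynomial_eq_zero_iff.mp fun i => hqP _ (hP i))))

lemma card_le_choose_of_isIsolatedSolution {n m r : ℕ}
    {U : Fin (n + 1 + (m + 1) - 2) → Matrix (Fin (n + 1)) (Fin (m + 1)) ℂ}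
    {cx : Fin (n + 1) → ℂ} {cy : Fin (m + 1) → ℂ} {p : Fin r → Fin (n + 1) ⊕ Fin (m + 1) → ℂ}
    (hinj : Function.Injective p) (hp : ∀ j, IsIsolatedSolution
      (sysP (n + 1) (m + 1) U cx cy) (p j ∘ Sum.inl, p j ∘ Sum.inr)) :
    r ≤ (n + m).choose n := by
  classical
  by_contra! hr
  have hN : n + 1 + (m + 1) - 2 = n + m := by omega
  let x : Fin (n + 1) → MvPolynomial (Fin (n + 1) ⊕ Fin (m + 1)) ℂ := fun l => X (Sum.inl l)
  let y : Fin (m + 1) → MvPolynomial (Fin (n + 1) ⊕ Fin (m + 1)) ℂ := fun l => X (Sum.inr l)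
  let VX := Submodule.span ℂ (Set.range x)
  let VY := Submodule.span ℂ (Set.range y)
  have hx : ∀ l, x l ∈ VX := fun l => Submodule.subset_span ⟨l, rfl⟩
  have hy : ∀ l, y l ∈ VY := fun l => Submodule.subset_span ⟨l, rfl⟩
  let L : ℕ → MvPolynomial (Fin (n + 1) ⊕ Fin (m + 1)) ℂ :=
    fun i => ∑ l : Fin (n + 1), (i : ℂ) ^ (l : ℕ) • x l
  let M : ℕ → MvPolynomial (Fin (n + 1) ⊕ Fin (m + 1)) ℂ :=
    fun i => ∑ l : Fin (m + 1), (i : ℂ) ^ (l : ℕ) • y l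
  have hL : ∀ i, L i ∈ VX := fun i => sum_mem fun l _ => VX.smul_mem _ (hx l)
  have hM : ∀ i, M i ∈ VY := fun i => sum_mem fun l _ => VY.smul_mem _ (hy l)
  let u : MvPolynomial (Fin (n + 1) ⊕ Fin (m + 1)) ℂ := ∑ l, cx l • x l
  let v : MvPolynomial (Fin (n + 1) ⊕ Fin (m + 1)) ℂ := ∑ l, cy l • y l
  have hu : u ∈ VX := sum_mem fun l _ => VX.smul_mem _ (hx l)
  have hv : v ∈ VY := sum_mem fun l _ => VY.smul_mem _ (hy l)
  let f := sysPPolynomial (n + 1) (m + 1) U cx cy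
  have hf : ∀ i, f (Sum.inl i) ∈ VX * VY := fun i => by
    change ∑ l, ∑ l', U i l l' • (x l * y l') ∈ _
    exact sum_mem fun l _ => sum_mem fun l' _ =>
      Submodule.smul_mem _ _ (Submodule.mul_mem_mul (hx l) (hy l'))
  let s : Fin (n + 1 + (m + 1) - 2) ⊕ Fin 2 → MvPolynomial (Fin (n + 1) ⊕ Fin (m + 1)) ℂ :=
    Sum.elim (fun i => L i * M i) 0
  have hpf : ∀ j i, eval (p j) (f i) = 0 :=
    fun j => forall_eval_sysPPolynomial_eq_zero_iff.mpr (hp j).1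
  have hpu : ∀ j, eval (p j) u = 1 := fun j => by
    have h : eval (p j) (u - 1) = 0 := hpf j (Sum.inr 0)
    simpa [sub_eq_zero] using h
  have hpv : ∀ j, eval (p j) v = 1 := fun j => by
    have h : eval (p j) (v - 1) = 0 := hpf j (Sum.inr 1)
    simpa [sub_eq_zero] using h
  obtain ⟨h, hV, hne, hzero⟩ := exists_interpolation (M := VX * VY) (a := n + m + r + 1)
    (by omega) (fun j => eval (p j)) (Submodule.mul_mem_mul hu hv) (by simp [hpu, hpv])
    fun i j hij => by
      obtain ⟨l | l, hl⟩ := Function.ne_iff.mp (hinj.ne hij)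
      · refine ⟨(x l - p i (Sum.inl l) • u) * v, Submodule.mul_mem_mul
          (VX.sub_mem (hx l) (VX.smul_mem _ hu)) hv, ?_, ?_⟩
        · simp [x, smul_eval, hpu]
        · simpa [x, smul_eval, hpu, hpv, sub_eq_zero] using hl.symm
      · refine ⟨u * (y l - p i (Sum.inr l) • v), Submodule.mul_mem_mul hu
          (VY.sub_mem (hy l) (VY.smul_mem _ hv)), ?_, ?_⟩
        · simp [y, smul_eval, hpv]
        · simpa [y, smul_eval, hpu, hpv, sub_eq_zero] using hl.symm
  obtain ⟨t, ht, hspan⟩ := exists_finset_le_span_sup_bigradedPart hL hM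
    (fun A hA => span_range_le_span_momentCurve x hA)
    (fun B hB => span_range_le_span_momentCurve y hB) (Finset.range (n + m)) ∅ ∅
    (n + m + r) (n + m + r) (by simp) (by simp) (by simp) (by simp) (by simp) (by simp)
  have himage : (fun i => L i * M i) '' (Finset.range (n + m) : Set ℕ) =
      Set.range fun i => s (Sum.inl i) := by
    ext g
    constructor
    · rintro ⟨i, hi, rfl⟩
      exact ⟨⟨i, by rw [hN]; simpa using hi⟩, rfl⟩
    · rintro ⟨i, rfl⟩
      exact ⟨i, by simpa using hN ▸ i.2, rfl⟩
  have hspan' : (VX * VY) ^ (n + m + r + 1) ≤ Submodule.span ℂ t ⊔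
      Submodule.span ℂ (Set.range fun i => s (Sum.inl i)) * (VX * VY) ^ (n + m + r) := by
    simpa [bigradedPart, mul_pow, ← himage] using hspan
  have : FiniteDimensional ℂ ((VX * VY) ^ (n + m + r + 1) :
      Submodule ℂ (MvPolynomial (Fin (n + 1) ⊕ Fin (m + 1)) ℂ)) :=
    Module.Finite.iff_fg.mpr (((Submodule.fg_span (Set.finite_range x)).mul
      (Submodule.fg_span (Set.finite_range y))).pow _)
  have hmul : ∀ g ∈ VX * VY, ∀ w ∈ (VX * VY) ^ (n + m + r), g * w ∈ (VX * VY) ^ (n + m + r + 1) :=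
    fun g hg w hw => by
      rw [pow_succ']
      exact Submodule.mul_mem_mul hg hw
  obtain ⟨c, N, ⟨j, hj⟩, hmem⟩ := exists_relation_mod_deformation
    (f := fun i => f (Sum.inl i)) (s := fun i => s (Sum.inl i))
    (fun i => hmul _ (hf i))
    (fun i => hmul _ (Submodule.mul_mem_mul (hL i) (hM i))) hspan'
    (lt_of_le_of_lt (by simpa using ht) hr) hV
  obtain ⟨P, hP, hXP, hfP, heval⟩ := exists_prime_of_deformation (by simp; omega) f s (p j)
    (hpf j) fun P _ hfP hPp => eq_ker_eval_of_isIsolatedSolution (hp j) hfP hPp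
  have hsum := (hP.mem_or_mem (Ideal.span_le.mpr
    (by rintro _ ⟨i, rfl⟩; exact hfP (Sum.inl i)) hmem)).resolve_left
      fun hX => hXP (hP.mem_of_pow_mem _ hX)
  have := heval _ hsum
  rw [Polynomial.eval_finsetSum, map_sum, Finset.sum_eq_single j
    (fun i _ hij => by simp [hzero j i hij.symm]) (by simp)] at this
  rw [Polynomial.eval_mul, map_mul, Polynomial.eval_C, ← Polynomial.coeff_zero_eq_eval_zero,
    Polynomial.coeff_map, mul_eq_zero] at this
  exact this.elim (by simpa [algebraMap_eq] using hj) (hne j)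

end BilinearSystem

/-- Theorem 3.8, Bézout bound: the system `sysP` has at most
`M = (I-1+J-1)! / ((I-1)!(J-1)!)` isolated solutions in `ℂ^{I+J}`. -/
theorem isolated_solutions_bound_bilinear (I J : ℕ) (hI : 1 ≤ I) (hJ : 1 ≤ J)
    (U : Fin (I + J - 2) → Matrix (Fin I) (Fin J) ℂ)
    (cx : Fin I → ℂ) (cy : Fin J → ℂ) :
    {p : (Fin I → ℂ) × (Fin J → ℂ) | IsIsolatedSolution (sysP I J U cx cy) p}.Finite ∧
      {p : (Fin I → ℂ) × (Fin J → ℂ) | IsIsolatedSolution (sysP I J U cx cy) p}.ncard ≤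
        (I - 1 + (J - 1)).factorial / ((I - 1).factorial * (J - 1).factorial) := by
  obtain ⟨n, rfl⟩ := Nat.exists_eq_add_of_le' hI
  obtain ⟨m, rfl⟩ := Nat.exists_eq_add_of_le' hJ
  set S := {p | IsIsolatedSolution (sysP (n + 1) (m + 1) U cx cy) p}
  have hcard : ∀ T : Finset ((Fin (n + 1) → ℂ) × (Fin (m + 1) → ℂ)), (T : Set _) ⊆ S →
      T.card ≤ (n + m).choose n := fun T hT =>
    card_le_choose_of_isIsolatedSolution (U := U) (cx := cx) (cy := cy)
      (p := fun i => Sum.elim (T.equivFin.symm i).1.1 (T.equivFin.symm i).1.2)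
      (fun i j hij => T.equivFin.symm.injective (Subtype.ext
        ((Equiv.sumArrowEquivProdArrow _ _ _).symm.injective hij)))
      fun j => hT (T.equivFin.symm j).2
  have hfin : S.Finite := by
    by_contra hinf
    obtain ⟨T, hT, hTc⟩ := Set.Infinite.exists_subset_card_eq hinf ((n + m).choose n + 1)
    have := hcard T hT
    omega
  refine ⟨hfin, ?_⟩
  rw [Set.ncard_eq_toFinset_card S hfin]
  refine (hcard _ (by simp)).trans_eq ?_
  simp only [Nat.add_sub_cancel]
  rw [add_comm n m, Nat.add_choose, mul_comm]
end

section
/- Let I, J, K ≥ 1, let u₁, …, u_{I+J+K−3} ∈ ℂ^{IJK}, c_x ∈ ℂ^I, c_y ∈ ℂ^J, c_z ∈ ℂ^K, and consider the polynomial system in (x, y, z) ∈ ℂ^I × ℂ^J × ℂ^K consisting of the I+J+K−3 trilinear equations u_j^⊤ (z ⊗ y ⊗ x) = 0 (j = 1, …, I+J+K−3) together with the three affine equations c_x^⊤ x = 1, c_y^⊤ y = 1 and c_z^⊤ z = 1. Then the number of isolated solutions of this system in ℂ^{I+J+K} is at most M = (I−1+J−1+K−1)! / ((I−1)!(J−1)!(K−1)!).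 -/
open Matrix

/-- The polynomial system in `(x, y, z) ∈ ℂ^I × ℂ^J × ℂ^K` consisting of the `I+J+K-3`
trilinear equations `u_jᵀ (z ⊗ y ⊗ x) = 0` together with the affine equations
`cxᵀ x = 1`, `cyᵀ y = 1`, `czᵀ z = 1`.  Here `ℂ^{IJK}` is indexed by triples
`(k, j, i) : Fin K × Fin J × Fin I` (position `(k-1)IJ + (j-1)I + i`), so
`(z ⊗ y ⊗ x) (k, j, i) = z_k * y_j * x_i`. -/
noncomputable def sysP3 (I J K : ℕ) (u : Fin (I + J + K - 3) → (Fin K × Fin J × Fin I → ℂ))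
    (cx : Fin I → ℂ) (cy : Fin J → ℂ) (cz : Fin K → ℂ)
    (q : (Fin I → ℂ) × (Fin J → ℂ) × (Fin K → ℂ)) :
    (Fin (I + J + K - 3) → ℂ) × ℂ × ℂ × ℂ :=
  (fun j => u j ⬝ᵥ (fun p : Fin K × Fin J × Fin I => q.2.2 p.1 * q.2.1 p.2.1 * q.1 p.2.2),
    cx ⬝ᵥ q.1 - 1, cy ⬝ᵥ q.2.1 - 1, cz ⬝ᵥ q.2.2 - 1)

theorem MvPolynomial.height_ker_add_card {R k : Type*} [CommRing R] [IsNoetherianRing R] [Field k]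
    {ι : Type*} [Finite ι] (φ : MvPolynomial ι R →+* k)
    (hφ : Function.Surjective (φ.comp MvPolynomial.C)) :
    (RingHom.ker φ).height = (RingHom.ker (φ.comp MvPolynomial.C)).height + Nat.card ι := by
  induction ι using Finite.induction_empty_option with
  | @of_equiv α β e H =>
    let f := (MvPolynomial.renameEquiv R e).toRingEquiv
    have h := H (φ.comp (f : MvPolynomial α R →+* MvPolynomial β R)) (by
      intro y
      obtain ⟨x, hx⟩ := hφ y
      exact ⟨x, by simpa [f] using hx⟩)
    have h1 : (φ.comp (f : MvPolynomial α R →+* MvPolynomial β R)).comp MvPolynomial.C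
        = φ.comp MvPolynomial.C := by
      ext x; simp [f]
    rw [h1, ← RingHom.comap_ker] at h
    rw [← Nat.card_congr e, ← h]
    exact (RingEquiv.height_comap f (RingHom.ker φ)).symm
  | h_empty =>
    have hb : Function.Bijective (MvPolynomial.C (σ := PEmpty) (R := R)) :=
      ⟨MvPolynomial.C_injective _ _, MvPolynomial.C_surjective _⟩
    let f := RingEquiv.ofBijective _ hb
    have := RingEquiv.height_comap f (RingHom.ker φ)
    simp only [Nat.card_eq_fintype_card, Fintype.card_pempty, Nat.cast_zero, add_zero]
    rw [← RingHom.comap_ker]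
    exact this.symm
  | @h_option α _ IH =>
    let f := (MvPolynomial.optionEquivLeft R α).toRingEquiv
    let ψ : Polynomial (MvPolynomial α R) →+* k := φ.comp (f.symm : _ →+* _)
    have hψ : (ψ.comp Polynomial.C).comp MvPolynomial.C = φ.comp MvPolynomial.C := by
      ext x
      have : f (MvPolynomial.C x) = Polynomial.C (MvPolynomial.C x) := by
        simp [f, MvPolynomial.optionEquivLeft_C]
      simp [ψ, ← this]
    have h := IH (ψ.comp Polynomial.C) (by rw [hψ]; exact hφ)
    rw [hψ] at h
    have hs : Function.Surjective ψ := by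
      intro y
      obtain ⟨x, hx⟩ := hφ y
      rw [← hψ] at hx
      exact ⟨_, hx⟩
    have : (RingHom.ker ψ).IsMaximal := RingHom.ker_isMaximal_of_surjective _ hs
    have : (RingHom.ker ψ).LiesOver (RingHom.ker (ψ.comp Polynomial.C)) :=
      ⟨by rw [← RingHom.comap_ker]; rfl⟩
    have h2 := Polynomial.height_eq_height_add_one (RingHom.ker (ψ.comp Polynomial.C))
      (RingHom.ker ψ)
    have h3 : (RingHom.ker ψ).height = (RingHom.ker φ).height := by
      rw [← RingHom.comap_ker]
      exact RingEquiv.height_comap f.symm (RingHom.ker φ)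
    rw [← h3, h2, h]
    simp [Nat.card_eq_fintype_card, add_assoc]

theorem Polynomial.exists_isRoot_norm_lt {P : Polynomial ℂ} (hP : P.Monic) {ε : ℝ}
    (hε : 0 < ε) (h : ‖P.coeff 0‖ < ε ^ P.natDegree) : ∃ τ, P.IsRoot τ ∧ ‖τ‖ < ε := by
  by_contra! hcon
  have hs : P.Splits := IsAlgClosed.splits P
  have key : ∀ s : Multiset ℂ, (∀ τ ∈ s, ε ≤ ‖τ‖) → ε ^ s.card ≤ ‖s.prod‖ := by
    intro s
    induction s using Multiset.induction_on with
    | empty => simp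
    | cons a s ih =>
      intro h
      simp only [Multiset.mem_cons, forall_eq_or_imp] at h
      rw [Multiset.card_cons, Multiset.prod_cons, norm_mul, pow_succ, mul_comm]
      gcongr
      exacts [h.1, ih h.2]
  have h1 := key P.roots fun τ hτ => hcon τ (Polynomial.isRoot_of_mem_roots hτ)
  rw [hs.coeff_zero_eq_prod_roots_of_monic hP] at h
  rw [← hs.natDegree_eq_card_roots] at h1
  simp at h
  linarith

theorem Polynomial.norm_le_sum_norm_coeff_of_isRoot {P : Polynomial ℂ} (hP : P.Monic) {τ : ℂ}
    (h : P.IsRoot τ) : ‖τ‖ ≤ (∑ k ∈ Finset.range P.natDegree, ‖P.coeff k‖) + 1 := by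
  have h1 := Polynomial.IsRoot.norm_lt_cauchyBound hP.ne_zero h
  have h2 : P.cauchyBound ≤ (∑ k ∈ Finset.range P.natDegree, ‖P.coeff k‖₊) + 1 := by
    rw [Polynomial.cauchyBound, hP.leadingCoeff]
    simp only [nnnorm_one, div_one]
    gcongr
    refine Finset.sup_le fun i hi => ?_
    exact Finset.single_le_sum (f := fun k => ‖P.coeff k‖₊) (fun _ _ => zero_le) hi
  have h3 := (h1.le.trans h2)
  have h4 : (‖τ‖₊ : ℝ) ≤ ((∑ k ∈ Finset.range P.natDegree, ‖P.coeff k‖₊ + 1 : NNReal) : ℝ) :=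
    NNReal.coe_le_coe.mpr h3
  simpa using h4

theorem MvPolynomial.exists_eval_eq_zero_of_finite {ι : Type*} {k : Type*} [Field k]
    {s : Set (ι → k)} (hs : s.Finite) (p : ι → k) :
    ∃ H : MvPolynomial ι k, MvPolynomial.eval p H = 0 ∧
      ∀ q ∈ s, q ≠ p → MvPolynomial.eval q H ≠ 0 := by
  classical
  have h1 : ∀ q : ι → k, ∃ G : MvPolynomial ι k, MvPolynomial.eval p G = 1 ∧
      (q ≠ p → MvPolynomial.eval q G = 0) := by
    intro q
    by_cases hq : q = p
    · exact ⟨1, by simp, fun h => absurd hq h⟩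
    · obtain ⟨i, hi⟩ := Function.ne_iff.mp hq
      refine ⟨MvPolynomial.C (p i - q i)⁻¹ * (MvPolynomial.X i - MvPolynomial.C (q i)), ?_, ?_⟩
      · have : p i - q i ≠ 0 := sub_ne_zero.mpr (Ne.symm hi)
        simp [this]
      · simp
  choose G hG1 hG2 using h1
  refine ⟨1 - ∏ q ∈ hs.toFinset, G q, by simp [hG1], fun q hq hqp => ?_⟩
  rw [map_sub, map_prod, Finset.prod_eq_zero (hs.mem_toFinset.mpr hq) (hG2 q hqp)]
  simp

theorem exists_maximal_of_isRoot_minpoly {B A k : Type*} [CommRing B] [IsDomain B]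
    [IsIntegrallyClosed B] [CommRing A] [IsDomain A] [Field k] [Algebra B A]
    [Algebra.IsIntegral B A] [Module.IsTorsionFree B A] (ψ : B →+* k)
    (hψ : Function.Surjective ψ) (h : A) (τ : k) (hτ : ((minpoly B h).map ψ).IsRoot τ) :
    ∃ Q : Ideal A, Q.IsMaximal ∧
      ∀ P : Polynomial B, Polynomial.eval₂ ψ τ P = 0 → Polynomial.aeval h P ∈ Q := by
  let f : Polynomial B →+* A := (Polynomial.aeval h : Polynomial B →ₐ[B] A).toRingHom
  let _ := f.toAlgebra
  have hf : algebraMap (Polynomial B) A = f := rfl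
  have : IsScalarTower B (Polynomial B) A := IsScalarTower.of_algebraMap_eq fun x => by
    simp [hf, f]
  have : Algebra.IsIntegral (Polynomial B) A := Algebra.IsIntegral.tower_top B
  let e : Polynomial B →+* k := Polynomial.eval₂RingHom ψ τ
  have he : Function.Surjective e := by
    intro y
    obtain ⟨x, rfl⟩ := hψ y
    exact ⟨Polynomial.C x, by simp [e]⟩
  have : (RingHom.ker e).IsMaximal := RingHom.ker_isMaximal_of_surjective _ he
  obtain ⟨Q, hQ, hQ'⟩ := Ideal.exists_ideal_over_maximal_of_isIntegral (S := A) (RingHom.ker e) (by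
    rw [hf, minpoly.ker_eval (Algebra.IsIntegral.isIntegral h), Ideal.span_singleton_le_iff_mem]
    simpa [e, Polynomial.IsRoot, Polynomial.eval_map] using hτ)
  refine ⟨Q, hQ, fun P hP => ?_⟩
  have : P ∈ Ideal.comap (algebraMap (Polynomial B) A) Q := by
    rw [hQ']; exact hP
  exact this

theorem MvPolynomial.exists_ne_zeroLocus_mem_nhds {ι : Type*} [Finite ι]
    (Q : Ideal (MvPolynomial ι ℂ)) [Q.IsPrime] (p : ι → ℂ)
    (hp : Q < RingHom.ker (MvPolynomial.eval p)) {s : Set (ι → ℂ)} (hs : s ∈ nhds p) :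
    ∃ q ∈ s, q ≠ p ∧ ∀ F ∈ Q, MvPolynomial.eval q F = 0 := by
  have := Fintype.ofFinite ι
  obtain ⟨d, g, hinj, hint⟩ := exists_integral_inj_algHom_of_fg ℂ (MvPolynomial ι ℂ ⧸ Q)
  let _ := g.toRingHom.toAlgebra
  let _ : Module (MvPolynomial (Fin d) ℂ) (MvPolynomial ι ℂ ⧸ Q) := Algebra.toModule
  have hg : algebraMap (MvPolynomial (Fin d) ℂ) (MvPolynomial ι ℂ ⧸ Q) = g.toRingHom := rfl
  have hI : Algebra.IsIntegral (MvPolynomial (Fin d) ℂ) (MvPolynomial ι ℂ ⧸ Q) := ⟨hint⟩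
  have : FaithfulSMul (MvPolynomial (Fin d) ℂ) (MvPolynomial ι ℂ ⧸ Q) :=
    (faithfulSMul_iff_algebraMap_injective _ _).mpr hinj
  have : Module.IsTorsionFree (MvPolynomial (Fin d) ℂ) (MvPolynomial ι ℂ ⧸ Q) := inferInstance
  rcases d with _ | d
  · exfalso
    have hF : IsField (MvPolynomial (Fin 0) ℂ) :=
      (MvPolynomial.isEmptyAlgEquiv ℂ (Fin 0)).toMulEquiv.isField (Field.toIsField ℂ)
    have := Ideal.Quotient.maximal_of_isField _ (isField_of_isIntegral_of_isField' hF (S := MvPolynomial ι ℂ ⧸ Q))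
    exact (this.1.2 _ hp) |> RingHom.ker_ne_top _
  choose L hL using Ideal.Quotient.mk_surjective (I := Q)
  let V : Set (ι → ℂ) := {q | ∀ F ∈ Q, MvPolynomial.eval q F = 0}
  have hpV : p ∈ V := fun F hF => hp.le hF
  let eA : ∀ q ∈ V, (MvPolynomial ι ℂ ⧸ Q) →ₐ[ℂ] ℂ := fun q hq =>
    Ideal.Quotient.liftₐ Q (MvPolynomial.aeval q) (fun F hF => hq F hF)
  have heA : ∀ q (hq : q ∈ V) F, eA q hq (Ideal.Quotient.mk Q F) = MvPolynomial.eval q F :=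
    fun q hq F => rfl
  let π : (ι → ℂ) → (Fin (d + 1) → ℂ) := fun q i => MvPolynomial.eval q (L (g (MvPolynomial.X i)))
  have hπ : ∀ q (hq : q ∈ V) b, eA q hq (g b) = MvPolynomial.eval (π q) b := by
    intro q hq b
    have : (eA q hq).comp g = MvPolynomial.aeval (π q) := by
      refine MvPolynomial.algHom_ext fun i => ?_
      simp only [AlgHom.comp_apply, MvPolynomial.aeval_X, π]
      rw [← heA q hq, hL]
    exact congrArg (fun f => f b) this
  have hroot : ∀ q (hq : q ∈ V) a,
      ((minpoly (MvPolynomial (Fin (d + 1)) ℂ) a).map (MvPolynomial.eval (π q))).IsRoot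
        (eA q hq a) := by
    intro q hq a
    have h1 := congrArg (eA q hq) (minpoly.aeval (MvPolynomial (Fin (d + 1)) ℂ) a)
    rw [Polynomial.aeval_def, Polynomial.eval₂_eq_sum_range, map_sum, map_zero] at h1
    rw [Polynomial.IsRoot, Polynomial.eval_map, Polynomial.eval₂_eq_sum_range, ← h1]
    refine Finset.sum_congr rfl fun i _ => ?_
    rw [map_mul, map_pow, ← hπ q hq]
    rfl
  have hmonic : ∀ a : MvPolynomial ι ℂ ⧸ Q, (minpoly (MvPolynomial (Fin (d + 1)) ℂ) a).Monic :=
    fun a => minpoly.monic (hI.isIntegral a)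
  have hfin : {q | q ∈ V ∧ π q = π p}.Finite := by
    let R : ι → Set ℂ := fun i =>
      {τ | ((minpoly (MvPolynomial (Fin (d + 1)) ℂ) (Ideal.Quotient.mk Q (MvPolynomial.X i))).map
        (MvPolynomial.eval (π p))).IsRoot τ}
    refine (Set.Finite.pi (t := R) fun i => ?_).subset ?_
    · exact Polynomial.finite_setOfPred_isRoot ((hmonic _).map _).ne_zero
    · rintro q ⟨hq, hqp⟩ i -
      have := hroot q hq (Ideal.Quotient.mk Q (MvPolynomial.X i))
      rw [hqp, heA, MvPolynomial.eval_X] at this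
      exact this
  obtain ⟨H, hHp, hH⟩ := MvPolynomial.exists_eval_eq_zero_of_finite hfin p
  set χ := minpoly (MvPolynomial (Fin (d + 1)) ℂ) (Ideal.Quotient.mk Q H) with hχ
  let b : ℂ → (Fin (d + 1) → ℂ) := fun t => Function.update (π p) 0 (π p 0 + t)
  have hb : Continuous b := by fun_prop
  have hb0 : b 0 = π p := by simp [b]
  have hcont : ∀ P : MvPolynomial (Fin (d + 1)) ℂ,
      Continuous fun t => MvPolynomial.eval (b t) P :=
    fun P => (MvPolynomial.continuous_eval P).comp hb
  have hc0 : MvPolynomial.eval (b 0) (χ.coeff 0) = 0 := by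
    have h1 := hroot p hpV (Ideal.Quotient.mk Q H)
    rw [heA, hHp, Polynomial.IsRoot, ← Polynomial.coeff_zero_eq_eval_zero,
      Polynomial.coeff_map] at h1
    rw [hb0]; exact h1
  have hseq : ∀ k : ℕ, ∃ t : ℂ, ∃ q ∈ V, t ≠ 0 ∧ ‖t‖ < 1 / ((k : ℝ) + 1) ∧ π q = b t ∧
      ‖MvPolynomial.eval q H‖ < 1 / ((k : ℝ) + 1) := by
    intro k
    have hε : 0 < 1 / ((k : ℝ) + 1) := by positivity
    have h1 : ∀ᶠ t in nhds (0 : ℂ), ‖MvPolynomial.eval (b t) (χ.coeff 0)‖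
        < (1 / ((k : ℝ) + 1)) ^ χ.natDegree := by
      have := (hcont (χ.coeff 0)).norm.tendsto 0
      rw [hc0, norm_zero] at this
      exact this.eventually_lt_const (by positivity)
    have h2 : ∀ᶠ t in nhds (0 : ℂ), ‖t‖ < 1 / ((k : ℝ) + 1) := by
      have := (continuous_norm (E := ℂ)).tendsto 0
      rw [norm_zero] at this
      exact this.eventually_lt_const hε
    obtain ⟨t, ⟨ht1, ht2⟩, ht3⟩ := (((h1.and h2).filter_mono nhdsWithin_le_nhds).and
      (self_mem_nhdsWithin : _ ∈ nhdsWithin (0 : ℂ) {0}ᶜ)).exists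
    have hm : (χ.map (MvPolynomial.eval (b t))).Monic := (hmonic _).map _
    obtain ⟨τ, hτ, hτ'⟩ := Polynomial.exists_isRoot_norm_lt hm hε (by
      rw [Polynomial.coeff_map, (hmonic _).natDegree_map]; exact ht1)
    obtain ⟨N, hN, hN'⟩ := exists_maximal_of_isRoot_minpoly (MvPolynomial.eval (b t))
      (fun y => ⟨MvPolynomial.C y, by simp⟩) (Ideal.Quotient.mk Q H) τ hτ
    have hNm : (N.comap (Ideal.Quotient.mk Q)).IsMaximal :=
      Ideal.comap_isMaximal_of_surjective _ Ideal.Quotient.mk_surjective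
    obtain ⟨q, hq⟩ := MvPolynomial.isMaximal_iff_eq_vanishingIdeal_singleton.mp hNm
    have hqN : ∀ F, Ideal.Quotient.mk Q F ∈ N → MvPolynomial.eval q F = 0 := by
      intro F hF
      have : F ∈ N.comap (Ideal.Quotient.mk Q) := hF
      rw [hq, MvPolynomial.mem_vanishingIdeal_singleton_iff] at this
      simpa using this
    have hqV : q ∈ V := fun F hF => hqN F (by
      rw [Ideal.Quotient.eq_zero_iff_mem.mpr hF]; exact N.zero_mem)
    refine ⟨t, q, hqV, ht3, ht2, ?_, ?_⟩
    · funext i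
      have h3 := hN' (Polynomial.C (MvPolynomial.X i - MvPolynomial.C (b t i))) (by simp)
      have h4 := hqN (L (g (MvPolynomial.X i)) - MvPolynomial.C (b t i)) (by
        rw [map_sub, hL]
        rw [Polynomial.aeval_C, hg] at h3
        convert h3 using 1
        simp only [AlgHom.toRingHom_eq_coe, RingHom.coe_coe, map_sub]
        congr 1
        exact (g.commutes (b t i)).symm)
      simpa [sub_eq_zero] using h4
    · have h3 := hN' (Polynomial.X - Polynomial.C (MvPolynomial.C τ)) (by simp)
      have h4 := hqN (H - MvPolynomial.C τ) (by
        rw [map_sub]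
        convert h3 using 1
        rw [map_sub, Polynomial.aeval_X, Polynomial.aeval_C, hg]
        congr 1
        exact (g.commutes τ).symm)
      have : MvPolynomial.eval q H = τ := by simpa [sub_eq_zero] using h4
      rwa [this]
  choose t q hqV ht0 ht hqb hqH using hseq
  have hlim0 : Filter.Tendsto (fun k : ℕ => 1 / ((k : ℝ) + 1)) Filter.atTop (nhds 0) :=
    tendsto_one_div_add_atTop_nhds_zero_nat
  have htlim : Filter.Tendsto t Filter.atTop (nhds 0) :=
    squeeze_zero_norm (fun k => (ht k).le) hlim0
  have hHlim : Filter.Tendsto (fun k => MvPolynomial.eval (q k) H) Filter.atTop (nhds 0) :=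
    squeeze_zero_norm (fun k => (hqH k).le) hlim0
  have hbdd : Bornology.IsBounded (Set.range q) := by
    have h1 : ∀ i, ∃ M, ∀ k, ‖q k i‖ ≤ M := by
      intro i
      set m := minpoly (MvPolynomial (Fin (d + 1)) ℂ) (Ideal.Quotient.mk Q (MvPolynomial.X i))
      have hc : Continuous fun t => (∑ k ∈ Finset.range m.natDegree,
          ‖MvPolynomial.eval (b t) (m.coeff k)‖) + 1 := by
        refine (continuous_finsetSum _ fun k _ => (hcont _).norm).add continuous_const
      obtain ⟨M, hM⟩ := ((hc.tendsto 0).comp htlim).bddAbove_range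
      refine ⟨M, fun k => le_trans ?_ (hM ⟨k, rfl⟩)⟩
      have h2 := hroot (q k) (hqV k) (Ideal.Quotient.mk Q (MvPolynomial.X i))
      rw [heA, MvPolynomial.eval_X, hqb] at h2
      have h3 := Polynomial.norm_le_sum_norm_coeff_of_isRoot ((hmonic _).map _) h2
      rw [(hmonic _).natDegree_map] at h3
      simp only [Polynomial.coeff_map] at h3
      exact h3
    choose M hM using h1
    refine (Bornology.IsBounded.pi fun i => Metric.isBounded_closedBall (x := 0) (r := M i)).subset
      (Set.range_subset_iff.mpr fun k => ?_)
    exact Set.mem_univ_pi.mpr fun i => mem_closedBall_zero_iff.mpr (hM i k)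
  obtain ⟨a, -, φ, hφ, ha⟩ := tendsto_subseq_of_bounded hbdd (fun k => ⟨k, rfl⟩)
  have hev : ∀ F : MvPolynomial ι ℂ, Filter.Tendsto (fun k => MvPolynomial.eval (q (φ k)) F)
      Filter.atTop (nhds (MvPolynomial.eval a F)) := fun F =>
    ((MvPolynomial.continuous_eval F).tendsto a).comp ha
  have haV : a ∈ V := fun F hF => tendsto_nhds_unique (hev F) (by
    simp only [hqV _ F hF]; exact tendsto_const_nhds)
  have haπ : π a = π p := by
    funext i
    refine tendsto_nhds_unique (hev (L (g (MvPolynomial.X i)))) ?_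
    have h1 : (fun k => MvPolynomial.eval (q (φ k)) (L (g (MvPolynomial.X i))))
        = fun k => b (t (φ k)) i := by
      funext k; exact congrFun (hqb (φ k)) i
    rw [h1, ← hb0]
    exact (((continuous_apply i).comp hb).tendsto 0).comp (htlim.comp hφ.tendsto_atTop)
  have haH : MvPolynomial.eval a H = 0 :=
    tendsto_nhds_unique (hev H) (hHlim.comp hφ.tendsto_atTop)
  have hap : a = p := by
    by_contra hne
    exact hH a ⟨haV, haπ⟩ hne haH
  rw [hap] at ha
  obtain ⟨k, hk⟩ := (ha.eventually_mem hs).exists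
  refine ⟨_, hk, fun h => ?_, hqV _⟩
  have h1 := congrFun (hqb (φ k)) 0
  simp only [Function.comp_apply] at h
  rw [h] at h1
  simp [b, ht0] at h1

namespace MvPolynomial

section WeightedGrading

attribute [local instance] MvPolynomial.weightedGradedAlgebra

variable {σ M : Type*} [AddCancelCommMonoid M] (w : σ → M)

theorem weightedHomogeneousComponent_mul_of_isWeightedHomogeneous {k : Type*} [CommRing k] {δ : M}
    {ℓ : MvPolynomial σ k} (hℓ : IsWeightedHomogeneous w ℓ δ) (v : MvPolynomial σ k) (d : M) :
    weightedHomogeneousComponent w (d + δ) (v * ℓ) = weightedHomogeneousComponent w d v * ℓ := by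
  classical
  have := DirectSum.coe_decompose_mul_add_of_right_mem
    (weightedHomogeneousSubmodule k w) (i := d) (j := δ) (a := v) (b := ℓ) hℓ
  rw [← weightedDecomposition.decompose'_apply, ← weightedDecomposition.decompose'_apply]
  exact this

/-- Modulo the ideal `J`, the weighted homogeneous part of degree `d` is spanned by at most `N`
of its elements. -/
def SpannedMod (J : Ideal (MvPolynomial σ ℂ)) (d : M) (N : ℕ) : Prop :=
  ∃ E : Finset (MvPolynomial σ ℂ), E.card ≤ N ∧ (∀ e ∈ E, IsWeightedHomogeneous w e d) ∧
    ∀ u, IsWeightedHomogeneous w u d → ∃ e ∈ Submodule.span ℂ (E : Set (MvPolynomial σ ℂ)), u - e ∈ J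

variable {w}

theorem SpannedMod.mono {J J' : Ideal (MvPolynomial σ ℂ)} {d : M} {N : ℕ} (h : SpannedMod w J d N)
    (hJ : J ≤ J') : SpannedMod w J' d N := by
  obtain ⟨E, h1, h2, h3⟩ := h
  exact ⟨E, h1, h2, fun u hu => (h3 u hu).imp fun e he => ⟨he.1, hJ he.2⟩⟩

theorem SpannedMod.zero {J : Ideal (MvPolynomial σ ℂ)} {d : M}
    (h : ∀ u, IsWeightedHomogeneous w u d → u ∈ J) : SpannedMod w J d 0 :=
  ⟨∅, by simp, by simp, fun u hu => ⟨0, by simp, by simpa using h u hu⟩⟩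

theorem SpannedMod.isWeightedHomogeneous_of_mem_span {E : Finset (MvPolynomial σ ℂ)} {d : M}
    (hE : ∀ e ∈ E, IsWeightedHomogeneous w e d) {e : MvPolynomial σ ℂ}
    (he : e ∈ Submodule.span ℂ (E : Set (MvPolynomial σ ℂ))) : IsWeightedHomogeneous w e d :=
  (Submodule.span_le (p := weightedHomogeneousSubmodule ℂ w d)).mpr (fun x hx => hE x hx) he

theorem SpannedMod.add [DecidableEq M] {J J' : Ideal (MvPolynomial σ ℂ)} {d δ : M} {N N' : ℕ}
    {ℓ : MvPolynomial σ ℂ}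
    (hJ : J.IsHomogeneous (weightedHomogeneousSubmodule ℂ w)) (hℓ : IsWeightedHomogeneous w ℓ δ)
    (h : SpannedMod w (J ⊔ Ideal.span {ℓ}) (d + δ) N) (h' : SpannedMod w J' d N')
    (hJ' : ∀ v ∈ J', v * ℓ ∈ J) : SpannedMod w J (d + δ) (N + N') := by
  classical
  obtain ⟨E, hE1, hE2, hE3⟩ := h
  obtain ⟨E', hE1', hE2', hE3'⟩ := h'
  refine ⟨E ∪ E'.image (· * ℓ), ?_, ?_, fun u hu => ?_⟩
  · exact (Finset.card_union_le _ _).trans (add_le_add hE1 (Finset.card_image_le.trans hE1'))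
  · intro e he
    rw [Finset.mem_union, Finset.mem_image] at he
    rcases he with he | ⟨e', he', rfl⟩
    · exact hE2 e he
    · exact (hE2' e' he').mul hℓ
  · obtain ⟨e, he, hue⟩ := hE3 u hu
    obtain ⟨j, hj, x, hx, hjx⟩ := Submodule.mem_sup.mp hue
    obtain ⟨v, rfl⟩ := Ideal.mem_span_singleton'.mp hx
    have hhom : IsWeightedHomogeneous w (u - e) (d + δ) :=
      hu.sub (SpannedMod.isWeightedHomogeneous_of_mem_span hE2 he)
    have h1 := congrArg (weightedHomogeneousComponent w (d + δ)) hjx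
    rw [map_add, weightedHomogeneousComponent_mul_of_isWeightedHomogeneous w hℓ,
      hhom.weightedHomogeneousComponent_same] at h1
    obtain ⟨e', he', hve'⟩ := hE3' _ (weightedHomogeneousComponent_isWeightedHomogeneous d v)
    refine ⟨e + e' * ℓ, ?_, ?_⟩
    · refine add_mem (Submodule.span_mono (by simp) he) ?_
      have : e' * ℓ ∈ (Submodule.span ℂ (E' : Set (MvPolynomial σ ℂ))).map
          (LinearMap.mulRight ℂ ℓ) := ⟨e', he', rfl⟩
      rw [Submodule.map_span] at this
      refine Submodule.span_mono ?_ this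
      rw [Finset.coe_union, Finset.coe_image]
      exact Set.subset_union_right
    · have h2 : u - (e + e' * ℓ) = weightedHomogeneousComponent w (d + δ) j
          + (weightedHomogeneousComponent w d v - e') * ℓ := by
        rw [sub_mul, ← sub_sub, ← h1]; ring
      rw [h2]
      exact J.add_mem (weightedHomogeneousComponent_mem_of_mem ℂ w hJ hj _) (hJ' _ hve')

theorem isHomogeneous_sup_span_singleton [DecidableEq M] {J : Ideal (MvPolynomial σ ℂ)} {δ : M}
    {ℓ : MvPolynomial σ ℂ} (hJ : J.IsHomogeneous (weightedHomogeneousSubmodule ℂ w))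
    (hℓ : IsWeightedHomogeneous w ℓ δ) :
    (J ⊔ Ideal.span {ℓ}).IsHomogeneous (weightedHomogeneousSubmodule ℂ w) :=
  hJ.sup (Ideal.homogeneous_span _ _ (by rintro x rfl; exact ⟨δ, hℓ⟩))

theorem SpannedMod.mul [DecidableEq M] {J : Ideal (MvPolynomial σ ℂ)} {d δ δ' : M} {N N' : ℕ}
    {a b : MvPolynomial σ ℂ}
    (hJ : J.IsHomogeneous (weightedHomogeneousSubmodule ℂ w)) (ha : IsWeightedHomogeneous w a δ)
    (hb : IsWeightedHomogeneous w b δ')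
    (h : SpannedMod w (J ⊔ Ideal.span {a}) (d + δ) N)
    (h' : SpannedMod w (J ⊔ Ideal.span {b}) d N') :
    SpannedMod w (J ⊔ Ideal.span {a * b}) (d + δ) (N + N') := by
  refine SpannedMod.add (isHomogeneous_sup_span_singleton hJ (ha.mul hb)) ha
    (h.mono (sup_le_sup_right le_sup_left _)) h' fun v hv => ?_
  obtain ⟨j, hj, x, hx, rfl⟩ := Submodule.mem_sup.mp hv
  obtain ⟨y, rfl⟩ := Ideal.mem_span_singleton'.mp hx
  rw [add_mul]
  refine add_mem (Ideal.mem_sup_left (J.mul_mem_right _ hj)) (Ideal.mem_sup_right ?_)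
  exact Ideal.mem_span_singleton'.mpr ⟨y, by ring⟩

theorem mem_of_isWeightedHomogeneous_of_X_mem {J : Ideal (MvPolynomial σ ℂ)} {d : M}
    (h : ∀ s : σ →₀ ℕ, Finsupp.weight w s = d → ∃ i, s i ≠ 0 ∧ X i ∈ J)
    {u : MvPolynomial σ ℂ} (hu : IsWeightedHomogeneous w u d) : u ∈ J := by
  rw [u.as_sum]
  refine J.sum_mem fun s hs => ?_
  obtain ⟨i, hi, hiJ⟩ := h s (hu (mem_support_iff.mp hs))
  refine J.mem_of_dvd ?_ hiJ
  exact X_dvd_monomial.mpr (Or.inr hi)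

end WeightedGrading

theorem mem_span_vandermonde {V : Type*} [AddCommGroup V] [Module ℂ V] {n : ℕ} (f : Fin n → V)
    {A : Finset ℕ} (hA : A.card = n) (i : Fin n) :
    f i ∈ Submodule.span ℂ ((fun a : ℕ => ∑ j : Fin n, (a : ℂ) ^ (j : ℕ) • f j) '' (A : Set ℕ)) := by
  classical
  let e : Fin n → ℕ := fun j => A.orderEmbOfFin hA j
  have he : Function.Injective e := (A.orderEmbOfFin hA).injective
  let W := Matrix.vandermonde (fun j => (e j : ℂ))
  have hW : IsUnit W.det := by
    rw [isUnit_iff_ne_zero, Matrix.det_vandermonde_ne_zero_iff]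
    exact Nat.cast_injective.comp he
  have h1 : f i = ∑ l, (W⁻¹ i l) • ∑ j : Fin n, (e l : ℂ) ^ (j : ℕ) • f j := by
    have h2 : ∀ j, ∑ l, W⁻¹ i l * W l j = if i = j then 1 else 0 := by
      intro j
      rw [← Matrix.mul_apply, Matrix.nonsing_inv_mul _ hW, Matrix.one_apply]
    simp only [Finset.smul_sum, smul_smul]
    rw [Finset.sum_comm]
    simp only [← Finset.sum_smul]
    rw [Finset.sum_eq_single i]
    · have := h2 i
      simp only [W, Matrix.vandermonde_apply, if_true] at this
      rw [this, one_smul]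
    · intro j _ hj
      have := h2 j
      simp only [W, Matrix.vandermonde_apply, if_neg (Ne.symm hj)] at this
      rw [this, zero_smul]
    · simp
  rw [h1]
  refine Submodule.sum_mem _ fun l _ => Submodule.smul_mem _ _ (Submodule.subset_span ⟨e l, ?_, rfl⟩)
  exact A.orderEmbOfFin_mem hA l

end MvPolynomial

/-- The trinomial coefficient `(a + b + c - 3)! / ((a - 1)! (b - 1)! (c - 1)!)`, or `0` if one of
`a`, `b`, `c` is `0`. -/
def trinomialRec : ℕ → ℕ → ℕ → ℕ
  | 0, _, _ => 0
  | _ + 1, 0, _ => 0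
  | _ + 1, _ + 1, 0 => 0
  | 1, 1, 1 => 1
  | a + 1, b + 1, c + 1 =>
    trinomialRec a (b + 1) (c + 1) + trinomialRec (a + 1) b (c + 1) + trinomialRec (a + 1) (b + 1) c
  termination_by a b c => a + b + c

theorem trinomialRec_mul_factorial (a b c : ℕ) :
    trinomialRec (a + 1) (b + 1) (c + 1) * (a.factorial * (b.factorial * c.factorial)) =
      (a + b + c).factorial := by
  induction hn : a + b + c generalizing a b c with
  | zero =>
    obtain ⟨rfl, rfl, rfl⟩ : a = 0 ∧ b = 0 ∧ c = 0 := by omega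
    simp [trinomialRec]
  | succ n ih =>
    have h0 : trinomialRec (a + 1) (b + 1) (c + 1) = trinomialRec a (b + 1) (c + 1) +
        trinomialRec (a + 1) b (c + 1) + trinomialRec (a + 1) (b + 1) c := by
      rw [trinomialRec]
      rintro rfl rfl rfl
      omega
    have h1 : trinomialRec a (b + 1) (c + 1) * (a.factorial * (b.factorial * c.factorial)) =
        a * n.factorial := by
      rcases a with _ | a
      · simp [trinomialRec]
      · rw [← ih a b c (by omega), Nat.factorial_succ]; ring
    have h2 : trinomialRec (a + 1) b (c + 1) * (a.factorial * (b.factorial * c.factorial)) =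
        b * n.factorial := by
      rcases b with _ | b
      · simp [trinomialRec]
      · rw [← ih a b c (by omega), Nat.factorial_succ]; ring
    have h3 : trinomialRec (a + 1) (b + 1) c * (a.factorial * (b.factorial * c.factorial)) =
        c * n.factorial := by
      rcases c with _ | c
      · simp [trinomialRec]
      · rw [← ih a b c (by omega), Nat.factorial_succ]; ring
    rw [h0, add_mul, add_mul, h1, h2, h3, ← add_mul, ← add_mul, hn, Nat.factorial_succ]

namespace TrilinearSystem

open MvPolynomial

attribute [local instance] MvPolynomial.weightedGradedAlgebra

variable {I J K : ℕ}

/-- The variables `x`, `y`, `z` of a trilinear system. -/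
abbrev Vars (I J K : ℕ) : Type := Fin I ⊕ Fin J ⊕ Fin K

/-- The tridegrees of the variables. -/
def tridegree : Vars I J K → ℕ × ℕ × ℕ :=
  Sum.elim (fun _ => (1, 0, 0)) (Sum.elim (fun _ => (0, 1, 0)) (fun _ => (0, 0, 1)))

theorem weight_tridegree (s : Vars I J K →₀ ℕ) :
    Finsupp.weight tridegree s =
      (∑ i, s (.inl i), ∑ j, s (.inr (.inl j)), ∑ k, s (.inr (.inr k))) := by
  rw [Finsupp.weight_apply, Finsupp.sum_fintype _ _ (by simp), Fintype.sum_sum_type,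
    Fintype.sum_sum_type]
  simp [tridegree, Prod.ext_iff, Prod.fst_sum, Prod.snd_sum]

/-- The linear form in `x` whose coefficient vector is the point `a` of the moment curve. -/
noncomputable def xForm (a : ℕ) : MvPolynomial (Vars I J K) ℂ :=
  ∑ i : Fin I, (a : ℂ) ^ (i : ℕ) • X (.inl i)

/-- The linear form in `y` whose coefficient vector is the point `a` of the moment curve. -/
noncomputable def yForm (a : ℕ) : MvPolynomial (Vars I J K) ℂ :=
  ∑ j : Fin J, (a : ℂ) ^ (j : ℕ) • X (.inr (.inl j))

/-- The linear form in `z` whose coefficient vector is the point `a` of the moment curve. -/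
noncomputable def zForm (a : ℕ) : MvPolynomial (Vars I J K) ℂ :=
  ∑ k : Fin K, (a : ℂ) ^ (k : ℕ) • X (.inr (.inr k))

theorem isWeightedHomogeneous_sum_smul_X {ι σ M : Type*} [AddCommMonoid M] (w : σ → M) (t : Finset ι)
    (c : ι → ℂ) (f : ι → σ) (d : M) (h : ∀ i, w (f i) = d) :
    IsWeightedHomogeneous w (∑ i ∈ t, c i • (X (f i) : MvPolynomial σ ℂ)) d := by
  refine IsWeightedHomogeneous.sum _ _ _ fun i _ => ?_
  rw [← h i]
  exact (weightedHomogeneousSubmodule ℂ w _).smul_mem _ (isWeightedHomogeneous_X ℂ w (f i))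

theorem xForm_isWeightedHomogeneous (a : ℕ) :
    IsWeightedHomogeneous tridegree (xForm a : MvPolynomial (Vars I J K) ℂ) (1, 0, 0) :=
  isWeightedHomogeneous_sum_smul_X _ _ _ _ _ fun _ => rfl

theorem yForm_isWeightedHomogeneous (a : ℕ) :
    IsWeightedHomogeneous tridegree (yForm a : MvPolynomial (Vars I J K) ℂ) (0, 1, 0) :=
  isWeightedHomogeneous_sum_smul_X _ _ _ _ _ fun _ => rfl

theorem zForm_isWeightedHomogeneous (a : ℕ) :
    IsWeightedHomogeneous tridegree (zForm a : MvPolynomial (Vars I J K) ℂ) (0, 0, 1) :=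
  isWeightedHomogeneous_sum_smul_X _ _ _ _ _ fun _ => rfl

/-- The `a`-th equation of the start system. -/
noncomputable def startForm (a : ℕ) : MvPolynomial (Vars I J K) ℂ :=
  zForm a * (yForm a * xForm a)

theorem startForm_isWeightedHomogeneous (a : ℕ) :
    IsWeightedHomogeneous tridegree (startForm a : MvPolynomial (Vars I J K) ℂ) (1, 1, 1) :=
  (zForm_isWeightedHomogeneous a).mul
    ((yForm_isWeightedHomogeneous a).mul (xForm_isWeightedHomogeneous a))

/-- The ideal generated by the first `n` equations of the start system and the linear forms
indexed by `A`, `B`, `C`. -/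
noncomputable def startIdeal (n : ℕ) (A B C : Finset ℕ) : Ideal (MvPolynomial (Vars I J K) ℂ) :=
  Ideal.span (startForm '' Set.Iio n) ⊔ Ideal.span (xForm '' (A : Set ℕ)) ⊔
    Ideal.span (yForm '' (B : Set ℕ)) ⊔ Ideal.span (zForm '' (C : Set ℕ))

theorem startIdeal_isHomogeneous (n : ℕ) (A B C : Finset ℕ) :
    (startIdeal n A B C : Ideal (MvPolynomial (Vars I J K) ℂ)).IsHomogeneous
      (weightedHomogeneousSubmodule ℂ tridegree) := by
  refine ((Ideal.IsHomogeneous.sup ?_ ?_).sup ?_).sup ?_ <;>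
  · refine Ideal.homogeneous_span _ _ ?_
    rintro _ ⟨a, -, rfl⟩
    first
    | exact ⟨_, startForm_isWeightedHomogeneous a⟩
    | exact ⟨_, xForm_isWeightedHomogeneous a⟩
    | exact ⟨_, yForm_isWeightedHomogeneous a⟩
    | exact ⟨_, zForm_isWeightedHomogeneous a⟩

theorem startIdeal_sup_xForm (n a : ℕ) (A B C : Finset ℕ) :
    (startIdeal n A B C ⊔ Ideal.span {xForm a} : Ideal (MvPolynomial (Vars I J K) ℂ)) =
      startIdeal n (insert a A) B C := by
  rw [startIdeal, startIdeal, Finset.coe_insert, Set.image_insert_eq, Ideal.span_insert]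
  ac_rfl

theorem startIdeal_sup_yForm (n a : ℕ) (A B C : Finset ℕ) :
    (startIdeal n A B C ⊔ Ideal.span {yForm a} : Ideal (MvPolynomial (Vars I J K) ℂ)) =
      startIdeal n A (insert a B) C := by
  rw [startIdeal, startIdeal, Finset.coe_insert, Set.image_insert_eq, Ideal.span_insert]
  ac_rfl

theorem startIdeal_sup_zForm (n a : ℕ) (A B C : Finset ℕ) :
    (startIdeal n A B C ⊔ Ideal.span {zForm a} : Ideal (MvPolynomial (Vars I J K) ℂ)) =
      startIdeal n A B (insert a C) := by
  rw [startIdeal, startIdeal, Finset.coe_insert, Set.image_insert_eq, Ideal.span_insert]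
  ac_rfl

theorem startIdeal_succ (n : ℕ) (A B C : Finset ℕ) :
    (startIdeal (n + 1) A B C : Ideal (MvPolynomial (Vars I J K) ℂ)) =
      startIdeal n A B C ⊔ Ideal.span {startForm n} := by
  have h : Set.Iio (n + 1) = insert n (Set.Iio n) := by
    ext x; simp
  rw [startIdeal, startIdeal, h, Set.image_insert_eq, Ideal.span_insert]
  ac_rfl

theorem mem_of_forms {n : ℕ} {f : Fin n → MvPolynomial (Vars I J K) ℂ}
    {L : Ideal (MvPolynomial (Vars I J K) ℂ)} {A : Finset ℕ} (hA : A.card = n)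
    (h : Ideal.span ((fun a : ℕ => ∑ j : Fin n, (a : ℂ) ^ (j : ℕ) • f j) '' (A : Set ℕ)) ≤ L)
    (i : Fin n) : f i ∈ L :=
  h (Submodule.span_le_restrictScalars ℂ (MvPolynomial (Vars I J K) ℂ) _
    (mem_span_vandermonde f hA i))

theorem spannedMod_zero_of_xForms {n : ℕ} {A B C : Finset ℕ} (hA : A.card = I) (a b c : ℕ) :
    SpannedMod tridegree (startIdeal n A B C : Ideal (MvPolynomial (Vars I J K) ℂ))
      (a + 1, b, c) 0 := by
  refine SpannedMod.zero fun u hu => mem_of_isWeightedHomogeneous_of_X_mem (fun s hs => ?_) hu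
  rw [weight_tridegree, Prod.mk.injEq] at hs
  obtain ⟨i, -, hi⟩ := Finset.exists_ne_zero_of_sum_ne_zero (hs.1.trans_ne a.succ_ne_zero)
  refine ⟨_, hi, mem_of_forms (f := fun i => X (.inl i)) hA ?_ i⟩
  exact le_sup_right.trans (le_sup_left.trans le_sup_left)

theorem spannedMod_zero_of_yForms {n : ℕ} {A B C : Finset ℕ} (hB : B.card = J) (a b c : ℕ) :
    SpannedMod tridegree (startIdeal n A B C : Ideal (MvPolynomial (Vars I J K) ℂ))
      (a, b + 1, c) 0 := by
  refine SpannedMod.zero fun u hu => mem_of_isWeightedHomogeneous_of_X_mem (fun s hs => ?_) hu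
  rw [weight_tridegree, Prod.mk.injEq, Prod.mk.injEq] at hs
  obtain ⟨i, -, hi⟩ := Finset.exists_ne_zero_of_sum_ne_zero (hs.2.1.trans_ne b.succ_ne_zero)
  refine ⟨_, hi, mem_of_forms (f := fun j => X (.inr (.inl j))) hB ?_ i⟩
  exact le_sup_right.trans le_sup_left

theorem spannedMod_zero_of_zForms {n : ℕ} {A B C : Finset ℕ} (hC : C.card = K) (a b c : ℕ) :
    SpannedMod tridegree (startIdeal n A B C : Ideal (MvPolynomial (Vars I J K) ℂ))
      (a, b, c + 1) 0 := by
  refine SpannedMod.zero fun u hu => mem_of_isWeightedHomogeneous_of_X_mem (fun s hs => ?_) hu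
  rw [weight_tridegree, Prod.mk.injEq, Prod.mk.injEq] at hs
  obtain ⟨i, -, hi⟩ := Finset.exists_ne_zero_of_sum_ne_zero (hs.2.2.trans_ne c.succ_ne_zero)
  refine ⟨_, hi, mem_of_forms (f := fun k => X (.inr (.inr k))) hC ?_ i⟩
  exact le_sup_right

theorem spannedMod_one {n : ℕ} {A B C : Finset ℕ} (hA : A.card + 1 = I) (hB : B.card + 1 = J)
    (hC : C.card + 1 = K) (a b c : ℕ) :
    SpannedMod tridegree (startIdeal n A B C : Ideal (MvPolynomial (Vars I J K) ℂ))
      (a, b, c) 1 := by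
  have hJ := startIdeal_isHomogeneous (I := I) (J := J) (K := K) n A B C
  induction a with
  | succ a ih =>
    obtain ⟨e, he⟩ := Infinite.exists_notMem_finset A
    refine SpannedMod.add (d := (a, b, c)) (N := 0) hJ (xForm_isWeightedHomogeneous e) ?_ ih
      fun v hv => Ideal.mul_mem_right _ _ hv
    rw [startIdeal_sup_xForm]
    exact spannedMod_zero_of_xForms (by rw [Finset.card_insert_of_notMem he, hA]) _ _ _
  | zero =>
  induction b with
  | succ b ih =>
    obtain ⟨e, he⟩ := Infinite.exists_notMem_finset B
    refine SpannedMod.add (d := (0, b, c)) (N := 0) hJ (yForm_isWeightedHomogeneous e) ?_ ih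
      fun v hv => Ideal.mul_mem_right _ _ hv
    rw [startIdeal_sup_yForm]
    exact spannedMod_zero_of_yForms (by rw [Finset.card_insert_of_notMem he, hB]) _ _ _
  | zero =>
  induction c with
  | succ c ih =>
    obtain ⟨e, he⟩ := Infinite.exists_notMem_finset C
    refine SpannedMod.add (d := (0, 0, c)) (N := 0) hJ (zForm_isWeightedHomogeneous e) ?_ ih
      fun v hv => Ideal.mul_mem_right _ _ hv
    rw [startIdeal_sup_zForm]
    exact spannedMod_zero_of_zForms (by rw [Finset.card_insert_of_notMem he, hC]) _ _ _
  | zero =>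
  refine ⟨{1}, by simp, fun e he => ?_, fun u hu => ?_⟩
  · rw [Finset.mem_singleton.mp he]
    exact isWeightedHomogeneous_one ℂ tridegree
  refine ⟨u, ?_, by simp⟩
  have h1 : ∀ s, coeff s u ≠ 0 → s = 0 := by
    intro s hs
    have h2 := hu hs
    rw [weight_tridegree, Prod.mk.injEq, Prod.mk.injEq] at h2
    simp only [Finset.sum_eq_zero_iff, Finset.mem_univ, true_imp_iff] at h2
    ext (i | j | k)
    exacts [h2.1 i, h2.2.1 j, h2.2.2 k]
  have h3 : u = coeff 0 u • (1 : MvPolynomial (Vars I J K) ℂ) := by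
    ext s
    by_cases hs : s = 0
    · simp [hs]
    · have : coeff s u = 0 := by
        by_contra h; exact hs (h1 s h)
      simp [this, coeff_one, Ne.symm hs]
  rw [h3]
  exact Submodule.smul_mem _ _ (Submodule.subset_span (by simp))

theorem spannedMod_startIdeal (n : ℕ) (A B C : Finset ℕ) (α β γ : ℕ) (hA : A.card + α = I)
    (hB : B.card + β = J) (hC : C.card + γ = K) (hn : α + β + γ = n + 3)
    (hA' : ∀ e ∈ A, n ≤ e) (hB' : ∀ e ∈ B, n ≤ e) (hC' : ∀ e ∈ C, n ≤ e) (a b c : ℕ) :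
    SpannedMod tridegree (startIdeal n A B C : Ideal (MvPolynomial (Vars I J K) ℂ))
      (a + n + 1, b + n + 1, c + n + 1) (trinomialRec α β γ) := by
  induction n generalizing A B C α β γ a b c with
  | zero =>
    rcases α with _ | α
    · rw [trinomialRec]
      exact spannedMod_zero_of_xForms hA _ _ _
    rcases β with _ | β
    · rw [trinomialRec]
      exact spannedMod_zero_of_yForms hB _ _ _
    rcases γ with _ | γ
    · rw [trinomialRec]
      exact spannedMod_zero_of_zForms hC _ _ _
    obtain ⟨rfl, rfl, rfl⟩ : α = 0 ∧ β = 0 ∧ γ = 0 := by omega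
    rw [zero_add, trinomialRec]
    exact spannedMod_one hA hB hC _ _ _
  | succ n ih =>
    rcases α with _ | α
    · rw [trinomialRec]
      exact spannedMod_zero_of_xForms hA _ _ _
    rcases β with _ | β
    · rw [trinomialRec]
      exact spannedMod_zero_of_yForms hB _ _ _
    rcases γ with _ | γ
    · rw [trinomialRec]
      exact spannedMod_zero_of_zForms hC _ _ _
    have hins : ∀ {D : Finset ℕ}, (∀ e ∈ D, n + 1 ≤ e) →
        (insert n D).card = D.card + 1 ∧ ∀ e ∈ insert n D, n ≤ e := by
      intro D hD
      refine ⟨Finset.card_insert_of_notMem fun h => absurd (hD n h) (by omega), fun e he => ?_⟩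
      rcases Finset.mem_insert.mp he with rfl | he
      · exact le_rfl
      · exact (Nat.le_succ n).trans (hD e he)
    have hle : ∀ {D : Finset ℕ}, (∀ e ∈ D, n + 1 ≤ e) → ∀ e ∈ D, n ≤ e :=
      fun hD e he => (Nat.le_succ n).trans (hD e he)
    have hJ := startIdeal_isHomogeneous (I := I) (J := J) (K := K) n A B C
    have hx := ih (insert n A) B C α (β + 1) (γ + 1) (by rw [(hins hA').1]; omega) hB hC (by omega)
      (hins hA').2 (hle hB') (hle hC') (a + 1) b c
    have hy := ih A (insert n B) C (α + 1) β (γ + 1) hA (by rw [(hins hB').1]; omega) hC (by omega)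
      (hle hA') (hins hB').2 (hle hC') (a + 1) (b + 1) c
    have hz := ih A B (insert n C) (α + 1) (β + 1) γ hA hB (by rw [(hins hC').1]; omega) (by omega)
      (hle hA') (hle hB') (hins hC').2 (a + 1) (b + 1) (c + 1)
    rw [← startIdeal_sup_xForm] at hx
    rw [← startIdeal_sup_yForm] at hy
    rw [← startIdeal_sup_zForm] at hz
    have e1 : ((a + 1 + n + 1, b + 1 + n + 1, c + n + 1) : ℕ × ℕ × ℕ)
        = (a + 1 + n + 1, b + n + 1, c + n + 1) + (0, 1, 0) := by
      rw [show b + 1 + n + 1 = b + n + 1 + 1 by omega]; rfl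
    have e2 : ((a + 1 + n + 1, b + 1 + n + 1, c + 1 + n + 1) : ℕ × ℕ × ℕ)
        = (a + 1 + n + 1, b + 1 + n + 1, c + n + 1) + (0, 0, 1) := by
      rw [show c + 1 + n + 1 = c + n + 1 + 1 by omega]; rfl
    have e3 : ((a + (n + 1) + 1, b + (n + 1) + 1, c + (n + 1) + 1) : ℕ × ℕ × ℕ)
        = (a + 1 + n + 1, b + 1 + n + 1, c + 1 + n + 1) := by
      simp only [Prod.mk.injEq]; omega
    have hyx := SpannedMod.mul hJ (yForm_isWeightedHomogeneous n) (xForm_isWeightedHomogeneous n)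
      (e1 ▸ hy) hx
    rw [← e1] at hyx
    have hzyx := SpannedMod.mul hJ (zForm_isWeightedHomogeneous n)
      ((yForm_isWeightedHomogeneous n).mul (xForm_isWeightedHomogeneous n)) (e2 ▸ hz) hyx
    have h0 : trinomialRec (α + 1) (β + 1) (γ + 1) = trinomialRec (α + 1) (β + 1) γ +
        (trinomialRec (α + 1) β (γ + 1) + trinomialRec α (β + 1) (γ + 1)) := by
      rw [trinomialRec]
      · ring
      · rintro rfl rfl rfl
        omega
    rw [h0, startIdeal_succ, e3, e2]
    exact hzyx

end TrilinearSystem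

namespace MvPolynomial

/-- Evaluation at the point `q` of the fibre at parameter `0`. -/
noncomputable def evalAtZero {ι : Type*} (q : ι → ℂ) : MvPolynomial ι (Polynomial ℂ) →+* ℂ :=
  eval₂Hom (Polynomial.evalRingHom 0) q

theorem evalAtZero_map_C {ι : Type*} (q : ι → ℂ) (F : MvPolynomial ι ℂ) :
    evalAtZero q (map Polynomial.C F) = eval q F := by
  rw [evalAtZero, coe_eval₂Hom, eval₂_map]
  have : (Polynomial.evalRingHom (0 : ℂ)).comp Polynomial.C = RingHom.id ℂ := by ext; simp
  rw [this, eval₂_id]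

theorem evalAtZero_C {ι : Type*} (q : ι → ℂ) (c : Polynomial ℂ) :
    evalAtZero q (C c) = c.eval 0 := by
  simp [evalAtZero]

theorem sub_map_eval_zero_mem_span {ι : Type*} (F : MvPolynomial ι (Polynomial ℂ)) :
    F - map Polynomial.C (map (Polynomial.evalRingHom 0) F) ∈
      Ideal.span {(C Polynomial.X : MvPolynomial ι (Polynomial ℂ))} := by
  induction F using MvPolynomial.induction_on with
  | C a =>
    obtain ⟨b, hb⟩ := Polynomial.X_dvd_sub_C (p := a)
    rw [map_C, map_C, ← C_sub]
    refine Ideal.mem_span_singleton.mpr ⟨C b, ?_⟩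
    rw [← C_mul, ← hb, Polynomial.coe_evalRingHom, Polynomial.coeff_zero_eq_eval_zero]
  | add p q hp hq =>
    rw [map_add, map_add, add_sub_add_comm]
    exact add_mem hp hq
  | mul_X p i hp =>
    rw [map_mul, map_mul, map_X, map_X, ← sub_mul]
    exact Ideal.mul_mem_right _ _ hp

/-- Krull's height theorem in the form of persistence of isolated zeros: an isolated zero of a
system with as many equations as unknowns lies on a component of any deformation of the system
which dominates the parameter line. -/
theorem exists_isPrime_of_isolated {ι κ : Type*} [Finite ι] [Finite κ]
    (hcard : Nat.card κ ≤ Nat.card ι) (G : κ → MvPolynomial ι (Polynomial ℂ)) (p : ι → ℂ)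
    (hp : ∀ k, evalAtZero p (G k) = 0) {s : Set (ι → ℂ)} (hs : s ∈ nhds p)
    (hiso : ∀ q ∈ s, (∀ k, evalAtZero q (G k) = 0) → q = p) :
    ∃ P : Ideal (MvPolynomial ι (Polynomial ℂ)), P.IsPrime ∧ (∀ k, G k ∈ P) ∧
      C Polynomial.X ∉ P ∧ P ≤ RingHom.ker (evalAtZero p) := by
  have hsurj : Function.Surjective ((evalAtZero p).comp C) := fun y =>
    ⟨Polynomial.C y, by simp [evalAtZero_C]⟩
  have hle : Ideal.span (Set.range G) ≤ RingHom.ker (evalAtZero p) := by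
    rw [Ideal.span_le]
    rintro _ ⟨k, rfl⟩
    exact hp k
  have hker : (RingHom.ker (evalAtZero p)).IsPrime := RingHom.ker_isPrime _
  obtain ⟨P, hPmin, hPm⟩ := Ideal.exists_minimalPrimes_le hle
  have hP : P.IsPrime := hPmin.1.1
  have hGP : ∀ k, G k ∈ P := fun k => hPmin.1.2 (Ideal.subset_span ⟨k, rfl⟩)
  refine ⟨P, hP, hGP, fun hX => ?_, hPm⟩
  have hsub : ∀ F : MvPolynomial ι (Polynomial ℂ), F - map Polynomial.C (map (Polynomial.evalRingHom 0) F) ∈ P := fun F =>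
    (Ideal.span_singleton_le_iff_mem P).mpr hX (sub_map_eval_zero_mem_span F)
  let Q := P.comap (map (σ := ι) (Polynomial.C (R := ℂ)))
  have hQ : Q.IsPrime := Ideal.comap_isPrime _ P
  have hQp : Q ≤ RingHom.ker (eval p) := fun F hF => by
    have := hPm hF
    rwa [RingHom.mem_ker, evalAtZero_map_C] at this
  have hmemQ : ∀ F ∈ P, map (Polynomial.evalRingHom 0) F ∈ Q := fun F hF => by
    have := P.sub_mem hF (hsub F)
    rwa [sub_sub_cancel] at this
  have heval : ∀ (q : ι → ℂ) F, eval q (map (Polynomial.evalRingHom 0) F) = evalAtZero q F := by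
    intro q F
    rw [eval_map]; rfl
  rcases hQp.lt_or_eq with hlt | heq
  · obtain ⟨q, hqs, hqp, hq⟩ := exists_ne_zeroLocus_mem_nhds Q p hlt hs
    refine hqp (hiso q hqs fun k => ?_)
    rw [← heval]
    exact hq _ (hmemQ _ (hGP k))
  · have hPeq : P = RingHom.ker (evalAtZero p) := by
      refine le_antisymm hPm fun F hF => ?_
      have h1 : map (Polynomial.evalRingHom 0) F ∈ Q := by
        rw [heq, RingHom.mem_ker, heval]
        exact hF
      have := P.add_mem (hsub F) h1
      rwa [sub_add_cancel] at this
    have h1 := Ideal.height_le_spanRank_toENat_of_mem_minimalPrimes _ P hPmin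
    have h2 : Cardinal.toENat (Submodule.spanRank (Ideal.span (Set.range G))) ≤ Nat.card κ := by
      have h3 : Submodule.spanRank (Ideal.span (Set.range G)) ≤ Cardinal.mk (Set.range G) :=
        Submodule.spanRank_span_le_card _
      refine (Cardinal.toENat.monotone' h3).trans ?_
      have h4 : (Nat.card (Set.range G) : ℕ∞) = ENat.card (Set.range G) := by simp
      refine h4.ge.trans ?_
      exact_mod_cast Finite.card_range_le G
    rw [hPeq, MvPolynomial.height_ker_add_card _ hsurj] at h1
    have h5 : (RingHom.ker ((evalAtZero p).comp C)).IsMaximal :=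
      RingHom.ker_isMaximal_of_surjective _ hsurj
    rw [IsPrincipalIdealRing.height_eq_one_of_isMaximal _ (Polynomial.not_isField ℂ)] at h1
    have h6 : ((1 + Nat.card ι : ℕ) : ℕ∞) ≤ (Nat.card ι : ℕ) := by
      push_cast
      exact h1.trans (h2.trans (by exact_mod_cast hcard))
    have := ENat.natCast_le_natCast.mp h6
    omega

theorem exists_eval_ne_zero_of_smul_X_mem {m : ℕ} (p : (Fin m → Polynomial ℂ) → Prop)
    (hp : ∀ c, p (fun i => Polynomial.X * c i) → p c) (c : Fin m → Polynomial ℂ) (hc : p c)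
    (i : Fin m) (hi : c i ≠ 0) : ∃ c', p c' ∧ ∃ j, (c' j).eval 0 ≠ 0 := by
  induction hn : (c i).natDegree using Nat.strong_induction_on generalizing c with
  | _ n ih =>
  by_cases h : ∃ j, (c j).eval 0 ≠ 0
  · exact ⟨c, hc, h⟩
  push Not at h
  have h1 : ∀ j, ∃ d, c j = Polynomial.X * d := fun j =>
    Polynomial.X_dvd_iff.mpr (by rw [Polynomial.coeff_zero_eq_eval_zero, h j])
  choose d hd using h1
  obtain rfl : c = fun j => Polynomial.X * d j := _root_.funext hd
  have hdi : d i ≠ 0 := right_ne_zero_of_mul hi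
  refine ih (d i).natDegree ?_ d (hp d hc) hdi rfl
  rw [← hn, Polynomial.natDegree_X_mul hdi]
  exact Nat.lt_succ_self _

end MvPolynomial

namespace MvPolynomial

open Polynomial in
/-- If `g` generates an ideal modulo which the homogeneous part of some degree is spanned by `N`
elements, then more than `N` polynomials of this degree are linearly dependent modulo the equations
of the linear deformation from `f` (at parameter `0`) to `g` (at parameter `1`). -/
theorem SpannedMod.exists_sum_mem_span {σ M κ : Type*} [AddCancelCommMonoid M] [Finite κ]
    {w : σ → M} {d δ : M} {N m : ℕ} {f g : κ → MvPolynomial σ ℂ}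
    (hf : ∀ j, IsWeightedHomogeneous w (f j) δ) (hg : ∀ j, IsWeightedHomogeneous w (g j) δ)
    (h : SpannedMod w (Ideal.span (Set.range g)) (d + δ) N)
    (hfin : {s : σ →₀ ℕ | Finsupp.weight w s = d + δ}.Finite) (hm : N < m)
    (H : Fin m → MvPolynomial σ ℂ) (hH : ∀ i, IsWeightedHomogeneous w (H i) (d + δ)) :
    ∃ c : Fin m → ℂ[X], c ≠ 0 ∧ ∑ i, C (c i) * map Polynomial.C (H i) ∈
      Ideal.span (Set.range fun j =>
        map Polynomial.C (g j) + C (Polynomial.X - 1) * map Polynomial.C (g j - f j)) := by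
  classical
  have := Fintype.ofFinite κ
  obtain ⟨E, hEN, hE, hspan⟩ := h
  set F : κ → MvPolynomial σ ℂ[X] := fun j =>
    map Polynomial.C (g j) + C (Polynomial.X - 1) * map Polynomial.C (g j - f j) with hF
  let S : Submodule ℂ[X] (MvPolynomial σ ℂ[X]) := (Ideal.span (Set.range F)).restrictScalars ℂ[X]
  let V : Submodule ℂ[X] (MvPolynomial σ ℂ[X]) :=
    Submodule.span ℂ[X] (map Polynomial.C '' (E : Set (MvPolynomial σ ℂ))) ⊔ S
  let T : Set (MvPolynomial σ ℂ[X]) :=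
    (fun s => map Polynomial.C (monomial s (1 : ℂ))) '' {s : σ →₀ ℕ | Finsupp.weight w s = d + δ}
  let U := Submodule.span ℂ[X] T
  have hU : ∀ u, IsWeightedHomogeneous w u (d + δ) → map Polynomial.C u ∈ U := by
    intro u hu
    rw [u.as_sum, map_sum]
    refine U.sum_mem fun s hs => ?_
    have h1 : map Polynomial.C (monomial s (coeff s u)) =
        Polynomial.C (coeff s u) • map Polynomial.C (monomial s (1 : ℂ)) := by
      rw [map_monomial, map_monomial, smul_monomial, map_one, smul_eq_mul, mul_one]
    rw [h1]
    exact U.smul_mem _ (Submodule.subset_span ⟨s, hu (mem_support_iff.mp hs), rfl⟩)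
  have hdec : ∀ u, IsWeightedHomogeneous w u (d + δ) → ∃ v ∈ U,
      map Polynomial.C u - (Polynomial.X - 1 : ℂ[X]) • v ∈ V := by
    intro u hu
    obtain ⟨e, he, hue⟩ := hspan u hu
    have hehom := SpannedMod.isWeightedHomogeneous_of_mem_span hE he
    obtain ⟨a, ha⟩ := Ideal.mem_span_range_iff_exists_fun.mp hue
    have hcomp : u = e + ∑ j, weightedHomogeneousComponent w d (a j) * g j := by
      have h1 : weightedHomogeneousComponent w (d + δ) (u - e) = u - e :=
        weightedHomogeneousComponent_of_mem (m := d + δ) (p := u - e)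
          ((weightedHomogeneousSubmodule ℂ w (d + δ)).sub_mem hu hehom) |>.trans (if_pos rfl)
      rw [← ha, map_sum] at h1
      simp_rw [weightedHomogeneousComponent_mul_of_isWeightedHomogeneous w (hg _)] at h1
      rw [h1, ha, add_sub_cancel]
    set b := fun j => weightedHomogeneousComponent w d (a j) with hb
    have hbhom : ∀ j, IsWeightedHomogeneous w (b j) d := fun j =>
      weightedHomogeneousComponent_isWeightedHomogeneous _ _
    refine ⟨- map Polynomial.C (∑ j, b j * (g j - f j)), U.neg_mem (hU _ ?_), ?_⟩
    · exact IsWeightedHomogeneous.sum _ _ _ fun j _ => (hbhom j).mul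
        ((weightedHomogeneousSubmodule ℂ w δ).sub_mem (hg j) (hf j))
    have h2 : map Polynomial.C u - (Polynomial.X - 1 : ℂ[X]) •
        (- map Polynomial.C (∑ j, b j * (g j - f j))) =
        map Polynomial.C e + ∑ j, map Polynomial.C (b j) * F j := by
      rw [smul_neg, sub_neg_eq_add, smul_eq_C_mul, hcomp, map_add, map_sum, map_sum,
        Finset.mul_sum, add_assoc, ← Finset.sum_add_distrib]
      congr 1
      refine Finset.sum_congr rfl fun j _ => ?_
      simp only [hF, map_mul, hb]
      ring
    rw [h2]
    refine V.add_mem (Submodule.mem_sup_left ?_) (Submodule.mem_sup_right ?_)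
    · have h3 : ∀ x ∈ Submodule.span ℂ (E : Set (MvPolynomial σ ℂ)), map Polynomial.C x ∈
          Submodule.span ℂ[X] (map Polynomial.C '' (E : Set (MvPolynomial σ ℂ))) := by
        intro x hx
        induction hx using Submodule.span_induction with
        | mem x hx => exact Submodule.subset_span ⟨x, hx, rfl⟩
        | zero => rw [map_zero]; exact zero_mem _
        | add x y _ _ hx hy => rw [map_add]; exact add_mem hx hy
        | smul r x _ hx =>
          rw [smul_eq_C_mul, map_mul, map_C, ← smul_eq_C_mul]
          exact Submodule.smul_mem _ _ hx
      exact h3 e he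
    · exact Ideal.sum_mem _ fun j _ => Ideal.mul_mem_left _ _ (Ideal.subset_span ⟨j, rfl⟩)
  obtain ⟨r, hr, hrU⟩ := Submodule.exists_sub_one_mem_and_smul_eq_zero_of_fg_of_le_smul
    (Ideal.span {(Polynomial.X - 1 : ℂ[X])}) (U.map V.mkQ)
    ((Submodule.fg_span (hfin.image _)).map _) (by
      rw [Submodule.map_span_le]
      rintro _ ⟨s, hs, rfl⟩
      obtain ⟨v, hv, hvV⟩ := hdec (monomial s 1) (isWeightedHomogeneous_monomial w s 1 hs)
      rw [← Submodule.ker_mkQ V, LinearMap.mem_ker, map_sub, sub_eq_zero] at hvV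
      dsimp only
      rw [hvV, map_smul]
      exact Submodule.smul_mem_smul (Ideal.mem_span_singleton_self _)
        (Submodule.mem_map_of_mem hv))
  have hr0 : r ≠ 0 := by
    rintro rfl
    obtain ⟨q, hq⟩ := Ideal.mem_span_singleton.mp hr
    simpa using congrArg (Polynomial.eval 1) hq
  have hHV : ∀ i, ∃ a : E → ℂ[X],
      r • map Polynomial.C (H i) - ∑ e : E, a e • map Polynomial.C (e : MvPolynomial σ ℂ) ∈ S := by
    intro i
    have h1 := hrU _ (Submodule.mem_map_of_mem (hU _ (hH i)))
    rw [← map_smul, ← LinearMap.mem_ker, Submodule.ker_mkQ] at h1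
    obtain ⟨y, hy, z, hz, hyz⟩ := Submodule.mem_sup.mp h1
    obtain ⟨a, ha⟩ := (Submodule.mem_span_image_finset_iff_exists_fun ℂ[X]).mp hy
    refine ⟨a, ?_⟩
    rw [← hyz, ← ha, add_sub_cancel_left]
    exact hz
  choose a ha using hHV
  have hdep : ¬ LinearIndependent ℂ[X] a := by
    intro hli
    have h1 := hli.fintype_card_le_finrank
    simp only [Fintype.card_fin, Module.finrank_fintype_fun_eq_card, Fintype.card_coe] at h1
    omega
  obtain ⟨c, hc, i, hci⟩ := Fintype.not_linearIndependent_iff.mp hdep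
  refine ⟨fun i => c i * r, fun h0 => mul_ne_zero hci hr0 (congrFun h0 i), ?_⟩
  have h1 : ∑ i, C (c i * r) * map Polynomial.C (H i) = ∑ i, c i • (r • map Polynomial.C (H i) -
      ∑ e : E, a i e • map Polynomial.C (e : MvPolynomial σ ℂ)) := by
    simp_rw [smul_sub, Finset.sum_sub_distrib, Finset.smul_sum]
    rw [Finset.sum_comm]
    have h2 : ∀ e, ∑ i, c i * a i e = 0 := fun e => by
      simpa using congrFun hc e
    simp_rw [smul_smul, ← Finset.sum_smul, h2, zero_smul, Finset.sum_const_zero, sub_zero,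
      smul_eq_C_mul]
  rw [h1]
  exact S.sum_mem fun i _ => S.smul_mem _ (ha i)

end MvPolynomial

namespace TrilinearSystem

open MvPolynomial

variable {I J K : ℕ}

theorem finite_setOf_weight_tridegree_eq (d : ℕ × ℕ × ℕ) :
    {s : Vars I J K →₀ ℕ | Finsupp.weight tridegree s = d}.Finite := by
  refine (Finsupp.finite_of_degree_le (d.1 + (d.2.1 + d.2.2))).subset fun s hs => ?_
  rw [Set.mem_ofPred_eq, weight_tridegree] at hs
  rw [Set.mem_ofPred_eq, ← hs, Finsupp.degree_eq_sum, Fintype.sum_sum_type, Fintype.sum_sum_type]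

/-- The linear form with coefficient vector `c` in the variables `f i`. -/
noncomputable def linForm {n : ℕ} (f : Fin n → Vars I J K) (c : Fin n → ℂ) :
    MvPolynomial (Vars I J K) ℂ :=
  ∑ i, c i • X (f i)

theorem eval_linForm {n : ℕ} (f : Fin n → Vars I J K) (c : Fin n → ℂ) (p : Vars I J K → ℂ) :
    eval p (linForm f c) = c ⬝ᵥ (p ∘ f) := by
  simp [linForm, dotProduct, smul_eval]

theorem isWeightedHomogeneous_linForm {n : ℕ} {d : ℕ × ℕ × ℕ} (f : Fin n → Vars I J K)
    (c : Fin n → ℂ) (h : ∀ i, tridegree (f i) = d) :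
    IsWeightedHomogeneous tridegree (linForm f c) d :=
  isWeightedHomogeneous_sum_smul_X _ _ _ _ _ h

/-- The trilinear form with coefficients `v`. -/
noncomputable def trilinForm (v : Fin K × Fin J × Fin I → ℂ) : MvPolynomial (Vars I J K) ℂ :=
  ∑ t, v t • (X (.inr (.inr t.1)) * X (.inr (.inl t.2.1)) * X (.inl t.2.2))

theorem trilinForm_isWeightedHomogeneous (v : Fin K × Fin J × Fin I → ℂ) :
    IsWeightedHomogeneous tridegree (trilinForm v) (1, 1, 1) :=
  IsWeightedHomogeneous.sum _ _ _ fun _ _ =>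
    (weightedHomogeneousSubmodule ℂ tridegree _).smul_mem _
      (((isWeightedHomogeneous_X ℂ tridegree _).mul (isWeightedHomogeneous_X ℂ tridegree _)).mul
        (isWeightedHomogeneous_X ℂ tridegree _))

theorem eval_trilinForm (v : Fin K × Fin J × Fin I → ℂ) (p : Vars I J K → ℂ) :
    eval p (trilinForm v) = v ⬝ᵥ fun t => p (.inr (.inr t.1)) * p (.inr (.inl t.2.1)) *
      p (.inl t.2.2) := by
  simp [trilinForm, dotProduct, smul_eval]

/-- The affine normalisation of the three groups of variables. -/
def IsNormalized (cx : Fin I → ℂ) (cy : Fin J → ℂ) (cz : Fin K → ℂ) (p : Vars I J K → ℂ) : Prop :=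
  cx ⬝ᵥ (p ∘ .inl) = 1 ∧ cy ⬝ᵥ (p ∘ .inr ∘ .inl) = 1 ∧ cz ⬝ᵥ (p ∘ .inr ∘ .inr) = 1

section Interpolation

variable {cx : Fin I → ℂ} {cy : Fin J → ℂ} {cz : Fin K → ℂ}

theorem exists_forms_eval_eq_one (cx : Fin I → ℂ) (cy : Fin J → ℂ) (cz : Fin K → ℂ)
    (v : Vars I J K) :
    ∃ L R : MvPolynomial (Vars I J K) ℂ, IsWeightedHomogeneous tridegree L (tridegree v) ∧
      (∀ Q, IsWeightedHomogeneous tridegree Q (tridegree v) →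
        IsWeightedHomogeneous tridegree (Q * R) (1, 1, 1)) ∧
      ∀ p, IsNormalized cx cy cz p → eval p L = 1 ∧ eval p R = 1 := by
  have hx := isWeightedHomogeneous_linForm (J := J) (K := K) (d := (1, 0, 0)) .inl cx fun _ => rfl
  have hy := isWeightedHomogeneous_linForm (I := I) (K := K) (d := (0, 1, 0)) (.inr ∘ .inl) cy
    fun _ => rfl
  have hz := isWeightedHomogeneous_linForm (I := I) (J := J) (d := (0, 0, 1)) (.inr ∘ .inr) cz
    fun _ => rfl
  rcases v with i | j | k
  · refine ⟨_, _, hx, fun Q hQ => hQ.mul (hy.mul hz), fun p hp => ?_⟩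
    simp only [map_mul, eval_linForm, hp.1, hp.2.1, hp.2.2, mul_one, and_self]
  · refine ⟨_, _, hy, fun Q hQ => hQ.mul (hx.mul hz), fun p hp => ?_⟩
    simp only [map_mul, eval_linForm, hp.1, hp.2.1, hp.2.2, mul_one, and_self]
  · refine ⟨_, _, hz, fun Q hQ => hQ.mul (hx.mul hy), fun p hp => ?_⟩
    simp only [map_mul, eval_linForm, hp.1, hp.2.1, hp.2.2, mul_one, and_self]

theorem exists_separating {p q : Vars I J K → ℂ} (hp : IsNormalized cx cy cz p)
    (hq : IsNormalized cx cy cz q) (hpq : p ≠ q) :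
    ∃ G : MvPolynomial (Vars I J K) ℂ, IsWeightedHomogeneous tridegree G (1, 1, 1) ∧
      eval p G = 1 ∧ eval q G = 0 := by
  obtain ⟨v, hv⟩ := Function.ne_iff.mp hpq
  obtain ⟨L, R, hL, hR, h1⟩ := exists_forms_eval_eq_one cx cy cz v
  let W := weightedHomogeneousSubmodule ℂ (tridegree (I := I) (J := J) (K := K)) (tridegree v)
  refine ⟨((p v - q v)⁻¹ • (X v - q v • L)) * R, hR _ (W.smul_mem _ (W.sub_mem
    (isWeightedHomogeneous_X ℂ tridegree v) (W.smul_mem _ hL))), ?_, ?_⟩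
  · simp [smul_eval, h1 p hp, sub_ne_zero.mpr hv]
  · simp [smul_eval, h1 q hq]

theorem exists_interpolating {m : ℕ} (p : Fin (m + 1) → Vars I J K → ℂ)
    (hp : ∀ i, IsNormalized cx cy cz (p i)) (hinj : Function.Injective p) (n : ℕ) :
    ∃ H : Fin (m + 1) → MvPolynomial (Vars I J K) ℂ,
      (∀ i, IsWeightedHomogeneous tridegree (H i) (m + n + 1, m + n + 1, m + n + 1)) ∧
      ∀ i j, eval (p j) (H i) = if i = j then 1 else 0 := by
  classical
  choose G hG h1 h0 using fun (i j) (h : i ≠ j) => exists_separating (hp i) (hp j) (hinj.ne h)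
  let L : MvPolynomial (Vars I J K) ℂ :=
    linForm .inl cx * linForm (.inr ∘ .inl) cy * linForm (.inr ∘ .inr) cz
  have hL : IsWeightedHomogeneous tridegree L (1, 1, 1) :=
    ((isWeightedHomogeneous_linForm (d := (1, 0, 0)) _ cx fun _ => rfl).mul
      (isWeightedHomogeneous_linForm (d := (0, 1, 0)) _ cy fun _ => rfl)).mul
      (isWeightedHomogeneous_linForm (d := (0, 0, 1)) _ cz fun _ => rfl)
  have hL1 : ∀ i, eval (p i) L = 1 := fun i => by
    simp only [L, map_mul, eval_linForm, (hp i).1, (hp i).2.1, (hp i).2.2, mul_one]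
  refine ⟨fun i => L ^ (n + 1) * ∏ j, if h : i ≠ j then G i j h else 1, fun i => ?_,
    fun i j => ?_⟩
  · have h2 := (hL.pow (n + 1)).mul (IsWeightedHomogeneous.prod Finset.univ
      (fun j => if h : i ≠ j then G i j h else 1)
      (fun j => if i ≠ j then ((1, 1, 1) : ℕ × ℕ × ℕ) else 0) fun j _ => ?_)
    · rw [← Finset.sum_filter, Finset.sum_const, Finset.filter_ne,
        Finset.card_erase_of_mem (Finset.mem_univ i), Finset.card_univ, Fintype.card_fin,
        Nat.add_sub_cancel, ← add_nsmul] at h2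
      convert h2 using 1
      simp only [Prod.smul_mk, smul_eq_mul, mul_one, Prod.mk.injEq]
      omega
    · by_cases h : i = j
      · simpa [h] using isWeightedHomogeneous_one ℂ tridegree
      · simpa [h] using hG i j h
  · rw [map_mul, map_pow, hL1, one_pow, one_mul, map_prod]
    split_ifs with h
    · subst h
      refine Finset.prod_eq_one fun l _ => ?_
      split_ifs with hl
      · exact h1 i l hl
      · exact map_one _
    · refine Finset.prod_eq_zero (Finset.mem_univ j) ?_
      rw [dif_pos h]
      exact h0 i j h

end Interpolation

/-- The polynomial system `sysP3` deformed linearly, in its trilinear part, to the start system. -/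
noncomputable def deformation (u : Fin (I + J + K - 3) → (Fin K × Fin J × Fin I → ℂ))
    (cx : Fin I → ℂ) (cy : Fin J → ℂ) (cz : Fin K → ℂ) :
    Fin (I + J + K - 3) ⊕ Fin 3 → MvPolynomial (Vars I J K) (Polynomial ℂ) :=
  Sum.elim
    (fun j => map Polynomial.C (startForm j) +
      C (Polynomial.X - 1) * map Polynomial.C (startForm j - trilinForm (u j)))
    ![map Polynomial.C (linForm .inl cx - 1), map Polynomial.C (linForm (.inr ∘ .inl) cy - 1),
      map Polynomial.C (linForm (.inr ∘ .inr) cz - 1)]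

theorem forall_evalAtZero_deformation_eq_zero_iff
    (u : Fin (I + J + K - 3) → (Fin K × Fin J × Fin I → ℂ))
    (cx : Fin I → ℂ) (cy : Fin J → ℂ) (cz : Fin K → ℂ) (p : Vars I J K → ℂ) :
    (∀ k, evalAtZero p (deformation u cx cy cz k) = 0) ↔
      sysP3 I J K u cx cy cz (p ∘ .inl, p ∘ .inr ∘ .inl, p ∘ .inr ∘ .inr) = 0 := by
  rw [Sum.forall, Fin.forall_fin_succ, Fin.forall_fin_two]
  simp [deformation, evalAtZero_map_C, evalAtZero_C, eval_linForm, eval_trilinForm, sysP3, Prod.ext_iff,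
    funext_iff]

theorem not_injective_isolated (hI : 1 ≤ I) (hJ : 1 ≤ J) (hK : 1 ≤ K)
    (u : Fin (I + J + K - 3) → (Fin K × Fin J × Fin I → ℂ))
    (cx : Fin I → ℂ) (cy : Fin J → ℂ) (cz : Fin K → ℂ)
    (P : Fin (trinomialRec I J K + 1) → (Fin I → ℂ) × (Fin J → ℂ) × (Fin K → ℂ))
    (hP : ∀ i, IsIsolatedSolution (sysP3 I J K u cx cy cz) (P i)) : ¬ Function.Injective P := by
  intro hinj
  let p : Fin (trinomialRec I J K + 1) → Vars I J K → ℂ := fun i =>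
    Sum.elim (P i).1 (Sum.elim (P i).2.1 (P i).2.2)
  let Ψ : (Vars I J K → ℂ) → (Fin I → ℂ) × (Fin J → ℂ) × (Fin K → ℂ) := fun q =>
    (q ∘ .inl, q ∘ .inr ∘ .inl, q ∘ .inr ∘ .inr)
  have hΨp : ∀ i, Ψ (p i) = P i := fun i => rfl
  have hΨinj : Function.Injective Ψ := by
    intro a b hab
    simp only [Ψ, Prod.mk.injEq] at hab
    ext (i | j | k)
    exacts [congrFun hab.1 i, congrFun hab.2.1 j, congrFun hab.2.2 k]
  have hΨ : Continuous Ψ := by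
    refine .prodMk ?_ (.prodMk ?_ ?_) <;> exact continuous_pi fun i => continuous_apply _
  have hpinj : Function.Injective p := fun i j h => hinj (by rw [← hΨp, ← hΨp, h])
  have hnorm : ∀ i, IsNormalized cx cy cz (p i) := by
    intro i
    have h1 := (hP i).1
    simp only [sysP3, Prod.mk_eq_zero, sub_eq_zero] at h1
    exact h1.2
  obtain ⟨H, hH, hHp⟩ := exists_interpolating p hnorm hpinj (I + J + K - 3)
  have hspan := spannedMod_startIdeal (I := I) (J := J) (K := K) (I + J + K - 3) ∅ ∅ ∅ I J K
    (by simp) (by simp) (by simp) (by omega) (by simp) (by simp) (by simp)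
    (trinomialRec I J K) (trinomialRec I J K) (trinomialRec I J K)
  have hideal : (startIdeal (I + J + K - 3) ∅ ∅ ∅ : Ideal (MvPolynomial (Vars I J K) ℂ)) =
      Ideal.span (Set.range fun j : Fin (I + J + K - 3) => startForm j) := by
    simp only [startIdeal, Finset.coe_empty, Set.image_empty, Ideal.span_empty, sup_bot_eq]
    congr 1
    ext x
    simp [Fin.exists_iff]
  rw [hideal] at hspan
  obtain ⟨c, hc, hcH⟩ := SpannedMod.exists_sum_mem_span (d := (_, _, _)) (δ := (1, 1, 1))
    (fun j => trilinForm_isWeightedHomogeneous (u j)) (fun j => startForm_isWeightedHomogeneous _)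
    hspan (finite_setOf_weight_tridegree_eq _) (Nat.lt_succ_self _) H hH
  have hprime : ∀ i, ∃ Q : Ideal (MvPolynomial (Vars I J K) (Polynomial ℂ)), Q.IsPrime ∧
      (∀ k, deformation u cx cy cz k ∈ Q) ∧ C Polynomial.X ∉ Q ∧
        Q ≤ RingHom.ker (evalAtZero (p i)) := by
    intro i
    obtain ⟨h1, s, hs, hiso⟩ := hP i
    refine exists_isPrime_of_isolated ?_ _ (p i) ?_ (hΨ.continuousAt.preimage_mem_nhds hs)
      fun q hq hq0 => hΨinj ?_
    · simp [Nat.card_eq_fintype_card]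
      omega
    · exact (forall_evalAtZero_deformation_eq_zero_iff u cx cy cz (p i)).mpr h1
    · exact hiso _ hq ((forall_evalAtZero_deformation_eq_zero_iff u cx cy cz q).mp hq0)
  choose Q hQ hdef hX hker using hprime
  obtain ⟨i, hi⟩ := Function.ne_iff.mp hc
  obtain ⟨c', hc', j, hj⟩ := exists_eval_ne_zero_of_smul_X_mem
    (fun c => ∀ l, ∑ i, C (c i) * map Polynomial.C (H i) ∈ Q l) (fun c h l => by
      have h1 := h l
      simp_rw [map_mul, mul_assoc, ← Finset.mul_sum] at h1
      exact ((hQ l).mem_or_mem h1).resolve_left (hX l)) c (fun l => by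
      refine Ideal.span_le.mpr ?_ hcH
      rintro _ ⟨k, rfl⟩
      exact hdef l (.inl k)) i hi
  have h1 := hker j (hc' j)
  rw [RingHom.mem_ker, map_sum] at h1
  simp only [map_mul, evalAtZero_C, evalAtZero_map_C, hHp, mul_ite, mul_one, mul_zero,
    Finset.sum_ite_eq', Finset.mem_univ, if_true] at h1
  exact hj h1

end TrilinearSystem

/-- the trilinear system `sysP3` has at most
`M = (I-1+J-1+K-1)! / ((I-1)!(J-1)!(K-1)!)` isolated solutions in `ℂ^{I+J+K}`. -/
theorem isolated_solutions_bound_trilinear (I J K : ℕ)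
    (hI : 1 ≤ I) (hJ : 1 ≤ J) (hK : 1 ≤ K)
    (u : Fin (I + J + K - 3) → (Fin K × Fin J × Fin I → ℂ))
    (cx : Fin I → ℂ) (cy : Fin J → ℂ) (cz : Fin K → ℂ) :
    {p : (Fin I → ℂ) × (Fin J → ℂ) × (Fin K → ℂ) |
        IsIsolatedSolution (sysP3 I J K u cx cy cz) p}.Finite ∧
      {p : (Fin I → ℂ) × (Fin J → ℂ) × (Fin K → ℂ) |
          IsIsolatedSolution (sysP3 I J K u cx cy cz) p}.ncard ≤
        (I - 1 + (J - 1) + (K - 1)).factorial /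
          ((I - 1).factorial * ((J - 1).factorial * (K - 1).factorial)) := by
  have hM : (I - 1 + (J - 1) + (K - 1)).factorial /
      ((I - 1).factorial * ((J - 1).factorial * (K - 1).factorial)) = trinomialRec I J K := by
    obtain ⟨a, rfl⟩ := Nat.exists_eq_add_of_le' hI
    obtain ⟨b, rfl⟩ := Nat.exists_eq_add_of_le' hJ
    obtain ⟨c, rfl⟩ := Nat.exists_eq_add_of_le' hK
    simp only [Nat.add_sub_cancel]
    rw [← trinomialRec_mul_factorial, Nat.mul_div_cancel _ (by positivity)]
  rw [hM]
  set A := {p : (Fin I → ℂ) × (Fin J → ℂ) × (Fin K → ℂ) |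
    IsIsolatedSolution (sysP3 I J K u cx cy cz) p}
  have hA : A.encard ≤ trinomialRec I J K := by
    by_contra! h
    obtain ⟨t, htA, ht⟩ := Set.exists_subset_encard_eq
      (k := ((trinomialRec I J K + 1 : ℕ) : ℕ∞)) (by exact_mod_cast Order.add_one_le_of_lt h)
    have htf : t.Finite := Set.finite_of_encard_eq_coe ht
    have := htf.fintype
    have hcard : Fintype.card t = trinomialRec I J K + 1 := by
      rw [Set.encard_eq_coe_toFinset_card, Set.toFinset_card] at ht
      exact_mod_cast ht
    let e := (Fintype.equivFinOfCardEq hcard).symm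
    exact TrilinearSystem.not_injective_isolated hI hJ hK u cx cy cz (fun i => (e i : _))
      (fun i => htA (e i).2) (Subtype.val_injective.comp e.injective)
  have hfin : A.Finite := Set.finite_of_encard_le_coe hA
  refine ⟨hfin, ?_⟩
  rw [← hfin.cast_ncard_eq] at hA
  exact_mod_cast hA
end
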